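/- arXiv:1201.2983 — 9 statements merged into one kernel-verified Lean document; each statement's English description precedes it below -/
import Mathlib

section
/- For every two integers n and k with 2 ≤ k ≤ n, the generalized k-connectivity of the complete graph K_n satisfies κ_k(K_n) = n − ⌈k/2⌉. -/
open SimpleGraph

/-- Trees `T 0, …, T (r-1)` are internally disjoint `S`-trees in `G`: each `T i` is a
subgraph of `G` that is a tree containing every vertex of `S`, the edge sets are pairwise
disjoint, and the vertex sets of any two distinct trees intersect exactly in `S`. -/
def IsInternallyDisjointSTrees {V : Type*} (G : SimpleGraph V) (S : Set V) {r : ℕ}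
    (T : Fin r → G.Subgraph) : Prop :=
  (∀ i, S ⊆ (T i).verts ∧ (T i).coe.IsTree) ∧
  Pairwise fun i j =>
    Disjoint (T i).edgeSet (T j).edgeSet ∧ (T i).verts ∩ (T j).verts = S

/-- The generalized `k`-connectivity `κ_k(G)`: the greatest positive integer `r` such that
for every set `S` of `k` vertices there are `r` internally disjoint `S`-trees in `G`. -/
noncomputable def genConn {V : Type*} (G : SimpleGraph V) (k : ℕ) : ℕ :=
  sSup {r : ℕ | 0 < r ∧ ∀ S : Finset V, S.card = k →
    ∃ T : Fin r → G.Subgraph, IsInternallyDisjointSTrees G (↑S) T}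

/-- The subgraph of the complete graph on the vertex set `A` whose edges join each vertex
to its image under the parent map `f`. -/
def parentSubgraph {V : Type*} (A : Set V) (f : V → V) : (⊤ : SimpleGraph V).Subgraph where
  verts := A
  Adj u v := u ∈ A ∧ v ∈ A ∧ u ≠ v ∧ (f u = v ∨ f v = u)
  adj_sub h := h.2.2.1
  edge_vert h := h.1
  symm := ⟨fun _ _ h => ⟨h.2.1, h.1, h.2.2.1.symm, h.2.2.2.symm⟩⟩

theorem parentSubgraph_coe_isTree {V : Type*} [Finite V] {A : Set V} {f : V → V} {r : V}
    (hr : r ∈ A) (hfr : f r = r) (hfA : ∀ v ∈ A, f v ∈ A) (hff : ∀ v ∈ A, f (f v) = r) :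
    (parentSubgraph A f).coe.IsTree := by
  classical
  have step : ∀ (v : V) (hv : v ∈ A),
      (parentSubgraph A f).coe.Reachable ⟨v, hv⟩ ⟨f v, hfA v hv⟩ := by
    intro v hv
    by_cases h : v = f v
    · have : (⟨v, hv⟩ : (parentSubgraph A f).verts) = ⟨f v, hfA v hv⟩ := Subtype.ext h
      rw [← this]
    · exact SimpleGraph.Adj.reachable (show (parentSubgraph A f).Adj v (f v) from
        ⟨hv, hfA v hv, h, Or.inl rfl⟩)
  have toRoot : ∀ v : (parentSubgraph A f).verts,
      (parentSubgraph A f).coe.Reachable v ⟨r, hr⟩ := by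
    rintro ⟨v, hv⟩
    have h := (step v hv).trans (step (f v) (hfA v hv))
    simpa only [hff v hv] using h
  have hconn : (parentSubgraph A f).coe.Connected :=
    { preconnected := fun u v => (toRoot u).trans (toRoot v).symm
      nonempty := ⟨⟨r, hr⟩⟩ }
  refine isTree_iff_connected_and_card.2 ⟨hconn, le_antisymm ?_
    hconn.card_vert_le_card_edgeSet_add_one⟩
  have hsub : (parentSubgraph A f).edgeSet ⊆ (fun v => s(v, f v)) '' (A \ {r}) := by
    intro e
    induction e with | _ u v
    rintro ⟨hu, hv, hne, h⟩
    rcases h with h | h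
    · refine ⟨u, ⟨hu, fun hur => hne ?_⟩, by simp [h]⟩
      rw [Set.mem_singleton_iff] at hur
      rw [← h, hur, hfr]
    · refine ⟨v, ⟨hv, fun hur => hne ?_⟩, by simp [h, Sym2.eq_swap]⟩
      rw [Set.mem_singleton_iff] at hur
      rw [← h, hur, hfr]
  have h1 : Nat.card (parentSubgraph A f).coe.edgeSet = (parentSubgraph A f).edgeSet.ncard := by
    rw [← Subgraph.image_coe_edgeSet_coe, Set.ncard_image_of_injective _
      (Sym2.map.injective Subtype.val_injective), Nat.card_coe_set_eq]
  have h2 : (parentSubgraph A f).edgeSet.ncard ≤ (A \ {r}).ncard :=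
    (Set.ncard_le_ncard hsub (Set.toFinite _)).trans (Set.ncard_image_le (Set.toFinite _))
  have h3 : (A \ {r}).ncard + 1 = A.ncard := Set.ncard_sdiff_singleton_add_one hr (Set.toFinite _)
  have h4 : Nat.card (parentSubgraph A f).verts = A.ncard := Nat.card_coe_set_eq A
  omega

/-- The parent map of the `i`-th tree in a family of edge-disjoint double stars: the centres
are `2 * i` (the root) and `2 * i + 1`. -/
def doubleStarParent (i x : ℕ) : ℕ :=
  if x / 2 = i then 2 * i else if i < x / 2 then 2 * i + x % 2 else 2 * i + 1 - x % 2

theorem doubleStarParent_lt {k i : ℕ} (hi : i < k / 2) (x : ℕ) : doubleStarParent i x < k := by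
  unfold doubleStarParent; split_ifs <;> omega

theorem doubleStarParent_root (i : ℕ) : doubleStarParent i (2 * i) = 2 * i := by
  unfold doubleStarParent; split_ifs <;> omega

theorem doubleStarParent_doubleStarParent (i x : ℕ) :
    doubleStarParent i (doubleStarParent i x) = 2 * i := by
  have h : doubleStarParent i x / 2 = i := by
    unfold doubleStarParent; split_ifs <;> omega
  rw [doubleStarParent, if_pos h]

theorem eq_of_doubleStarParent_eq {i j x y : ℕ} (hne : x ≠ y)
    (hi : doubleStarParent i x = y ∨ doubleStarParent i y = x)
    (hj : doubleStarParent j x = y ∨ doubleStarParent j y = x) : i = j := by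
  unfold doubleStarParent at hi hj
  split_ifs at hi hj <;> omega

section UpperBound

variable {V : Type*} [Fintype V] {S : Finset V} {r : ℕ} {T : Fin r → (⊤ : SimpleGraph V).Subgraph}

theorem IsInternallyDisjointSTrees.card_verts_ne_le
    (hT : IsInternallyDisjointSTrees ⊤ (S : Set V) T) [DecidablePred fun i => (T i).verts = S] :
    (Finset.univ.filter fun i => ¬ (T i).verts = S).card + S.card ≤ Fintype.card V := by
  classical
  have hex : ∀ i : {i // ¬ (T i).verts = S}, ∃ v, v ∈ (T i).verts ∧ v ∉ S := by
    rintro ⟨i, hi⟩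
    by_contra! h
    exact hi (Set.Subset.antisymm h (hT.1 i).1)
  choose g hg using hex
  have hinj : Function.Injective fun i => (⟨g i, (hg i).2⟩ : {v // v ∉ S}) := by
    intro i j hij
    by_contra hne
    have hgij : g i = g j := congrArg Subtype.val hij
    have : g i ∈ (T i).verts ∩ (T j).verts := ⟨(hg i).1, hgij ▸ (hg j).1⟩
    rw [(hT.2 fun h => hne (Subtype.ext h)).2] at this
    exact (hg i).2 this
  have hle := Fintype.card_le_of_injective _ hinj
  rw [Fintype.card_subtype, Fintype.card_subtype_compl, Fintype.card_coe] at hle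
  have := S.card_le_univ
  omega

theorem IsInternallyDisjointSTrees.card_verts_eq_le
    (hT : IsInternallyDisjointSTrees ⊤ (S : Set V) T) (hS : 2 ≤ S.card)
    [DecidablePred fun i => (T i).verts = S] :
    (Finset.univ.filter fun i => (T i).verts = S).card ≤ S.card / 2 := by
  classical
  set I := Finset.univ.filter fun i => (T i).verts = S
  have hcard : ∀ i ∈ I, (T i).edgeSet.toFinset.card = S.card - 1 := by
    intro i hi
    have hi : (T i).verts = S := by simpa [I] using hi
    have h1 := (isTree_iff_connected_and_card.1 (hT.1 i).2).2
    have h2 : Nat.card (T i).coe.edgeSet = (T i).edgeSet.ncard := by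
      rw [← Subgraph.image_coe_edgeSet_coe, Set.ncard_image_of_injective _
        (Sym2.map.injective Subtype.val_injective), Nat.card_coe_set_eq]
    have h3 : Nat.card (T i).verts = S.card := by
      rw [Nat.card_coe_set_eq, hi, Set.ncard_coe_finset]
    rw [← Set.ncard_eq_toFinset_card']
    omega
  have hsub : I.biUnion (fun i => (T i).edgeSet.toFinset) ⊆ S.offDiag.image Sym2.mk.uncurry := by
    intro e he
    obtain ⟨i, hi, he⟩ := Finset.mem_biUnion.1 he
    have hi : (T i).verts = S := by simpa [I] using hi
    rw [Set.mem_toFinset] at he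
    induction e with | _ u v
    have huv : (T i).Adj u v := he
    refine Finset.mem_image.2 ⟨(u, v), Finset.mem_offDiag.2 ⟨?_, ?_, huv.ne⟩, rfl⟩
    · exact Finset.mem_coe.1 (hi ▸ huv.fst_mem)
    · exact Finset.mem_coe.1 (hi ▸ huv.snd_mem)
  have hle := Finset.card_le_card hsub
  rw [Finset.card_biUnion, Finset.sum_congr rfl hcard, Finset.sum_const, smul_eq_mul,
    Sym2.card_image_offDiag, Nat.choose_two_right] at hle
  · have h2 : I.card * 2 * (S.card - 1) ≤ S.card * (S.card - 1) := by
      have := Nat.div_mul_le_self (S.card * (S.card - 1)) 2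
      nlinarith
    have := Nat.le_of_mul_le_mul_right h2 (by omega)
    omega
  · intro i _ j _ hij
    exact Set.disjoint_toFinset.2 (hT.2 hij).1

end UpperBound

theorem exists_isInternallyDisjointSTrees_top {V : Type*} [Fintype V] (S : Finset V) {r : ℕ}
    (hr : r = S.card / 2 + (Fintype.card V - S.card)) :
    ∃ T : Fin r → (⊤ : SimpleGraph V).Subgraph,
      IsInternallyDisjointSTrees ⊤ (S : Set V) T := by
  classical
  let g : V → ℕ := fun v => if h : v ∈ S then S.equivFin ⟨v, h⟩ else 0
  let p : ℕ → V → V := fun i v =>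
    if h : doubleStarParent i (g v) < S.card then S.equivFin.symm ⟨_, h⟩ else v
  have hp : ∀ i < S.card / 2, ∀ v, p i v ∈ S ∧ g (p i v) = doubleStarParent i (g v) := by
    intro i hi v
    have h := doubleStarParent_lt hi (g v)
    simp only [p, dif_pos h]
    simp [g]
  have hg : ∀ u ∈ S, ∀ v ∈ S, g u = g v → u = v := by
    intro u hu v hv h
    simpa [g, hu, hv, Fin.val_inj] using h
  let U : Fin (S.card / 2) ⊕ {v // v ∉ S} → (⊤ : SimpleGraph V).Subgraph :=
    Sum.elim (fun i => parentSubgraph S (p i))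
      (fun c => parentSubgraph (insert c.1 (S : Set V)) fun _ => c)
  have hstar : ∀ (c : {v // v ∉ S}) e, e ∈ (U (.inr c)).edgeSet → c.1 ∈ e := by
    intro c e
    induction e with | _ u v
    rintro ⟨-, -, -, h | h⟩
    · exact Sym2.mem_iff.2 (Or.inr h)
    · exact Sym2.mem_iff.2 (Or.inl h)
  have hmem : ∀ i e x, e ∈ (U i).edgeSet → x ∈ e → x ∈ (U i).verts := fun i e x he hx =>
    (U i).mem_verts_of_mem_edge he hx
  have hcard : Fintype.card (Fin (S.card / 2) ⊕ {v // v ∉ S}) = r := by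
    rw [Fintype.card_sum, Fintype.card_fin, Fintype.card_subtype_compl, hr]
    simp
  have htree : ∀ i, (S : Set V) ⊆ (U i).verts ∧ (U i).coe.IsTree := by
    rintro (i | c)
    · refine ⟨subset_rfl, ?_⟩
      have hroot : 2 * (i : ℕ) < S.card := by omega
      refine parentSubgraph_coe_isTree (r := S.equivFin.symm ⟨2 * i, hroot⟩) (by simp) ?_
        (fun v _ => (hp i i.2 v).1) fun v _ => ?_
      · apply hg _ (hp i i.2 _).1 _ (by simp)
        rw [(hp i i.2 _).2]
        simp [g, doubleStarParent_root]
      · apply hg _ (hp i i.2 _).1 _ (by simp)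
        rw [(hp i i.2 _).2, (hp i i.2 _).2, doubleStarParent_doubleStarParent]
        simp [g]
    · exact ⟨Set.subset_insert _ _, parentSubgraph_coe_isTree (Set.mem_insert _ _) rfl
        (fun _ _ => Set.mem_insert _ _) fun _ _ => rfl⟩
  have hverts : ∀ i j, i ≠ j → (U i).verts ∩ (U j).verts = S := by
    rintro (i | c) (j | d) hne
    · exact Set.inter_self _
    · exact Set.inter_eq_left.2 (Set.subset_insert _ _)
    · exact Set.inter_eq_right.2 (Set.subset_insert _ _)
    · have hcd : c.1 ≠ d.1 := fun h => hne (congrArg _ (Subtype.ext h))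
      ext x
      simp only [U, Sum.elim_inr, parentSubgraph, Set.mem_inter_iff, Set.mem_insert_iff,
        Finset.mem_coe]
      constructor
      · rintro ⟨rfl | h, h' | h'⟩ <;> first | assumption | exact absurd h' hcd
      · exact fun h => ⟨Or.inr h, Or.inr h⟩
  have hedges : ∀ i j, i ≠ j → Disjoint (U i).edgeSet (U j).edgeSet := by
    intro i j hne
    rw [Set.disjoint_left]
    intro e hi hj
    have hS : ∀ x ∈ e, x ∈ S := fun x hx => by
      have : x ∈ (U i).verts ∩ (U j).verts := ⟨hmem _ _ _ hi hx, hmem _ _ _ hj hx⟩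
      rwa [hverts i j hne] at this
    rcases i with i | c
    · rcases j with j | d
      · induction e with | _ u v
        obtain ⟨hu, hv, huv, h⟩ := hi
        obtain ⟨-, -, -, h'⟩ := hj
        have key : ∀ l : Fin (S.card / 2), p l u = v ∨ p l v = u →
            doubleStarParent l (g u) = g v ∨ doubleStarParent l (g v) = g u := by
          rintro l (h | h)
          · left; rw [← (hp l l.2 u).2, h]
          · right; rw [← (hp l l.2 v).2, h]
        exact hne (congrArg _ (Fin.ext (eq_of_doubleStarParent_eq
          (fun h => huv (hg u hu v hv h)) (key i h) (key j h'))))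
      · exact d.2 (hS _ (hstar d e hj))
    · exact c.2 (hS _ (hstar c e hi))
  let φ := (Fintype.equivFinOfCardEq hcard).symm
  exact ⟨fun i => U (φ i), fun i => htree _, fun i j hij =>
    ⟨hedges _ _ (φ.injective.ne hij), hverts _ _ (φ.injective.ne hij)⟩⟩

theorem genConn_completeGraph (n k : ℕ) (hk : 2 ≤ k) (hkn : k ≤ n) :
    genConn (⊤ : SimpleGraph (Fin n)) k = n - (k + 1) / 2 := by
  classical
  refine IsGreatest.csSup_eq ⟨⟨by omega, fun S hS => ?_⟩, ?_⟩
  · apply exists_isInternallyDisjointSTrees_top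
    rw [Fintype.card_fin, hS]
    omega
  · rintro r ⟨-, h⟩
    obtain ⟨S, -, hS⟩ := Finset.exists_subset_card_eq
      (show k ≤ (Finset.univ : Finset (Fin n)).card by simpa using hkn)
    obtain ⟨T, hT⟩ := h S hS
    have h1 := hT.card_verts_ne_le
    have h2 := hT.card_verts_eq_le (by omega)
    have h3 := Finset.card_filter_add_card_filter_not (s := Finset.univ)
      fun i => (T i).verts = (S : Set (Fin n))
    rw [Finset.card_univ, Fintype.card_fin] at h3
    rw [Fintype.card_fin] at h1
    omega
end

section
/- Let n ≥ 4 and let G be the graph obtained from the complete graph K_n by deleting an edge set M. If the maximum degree of the subgraph K_n[M] induced by the edges of M is at least 3, then κ_3(G) ≤ n − 4. -/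
open SimpleGraph

/-- Internally disjoint trees on a set with at least two vertices leave any vertex `v` of the set
through distinct neighbours, so their number is at most the degree of `v`. -/
theorem IsInternallyDisjointSTrees.le_ncard_neighborSet {V : Type*} [Finite V]
    {G : SimpleGraph V} {S : Set V} {r : ℕ} {T : Fin r → G.Subgraph}
    (hT : IsInternallyDisjointSTrees G S T) {v w : V} (hv : v ∈ S) (hw : w ∈ S) (hvw : v ≠ w) :
    r ≤ (G.neighborSet v).ncard := by
  have hadj : ∀ i, ∃ u, (T i).Adj v u := fun i => by
    obtain ⟨hS, htree⟩ := hT.1 i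
    obtain ⟨p⟩ := htree.connected.preconnected ⟨v, hS hv⟩ ⟨w, hS hw⟩
    cases p with
    | nil => exact absurd rfl hvw
    | cons h _ => exact ⟨_, h⟩
  choose u hu using hadj
  have hinj : Function.Injective u := fun i j hij => by
    by_contra hne
    have hj : s(v, u i) ∈ (T j).edgeSet := hij ▸ hu j
    exact Set.disjoint_left.mp (hT.2 hne).1 (Subgraph.mem_edgeSet.mpr (hu i)) hj
  calc r = (Set.range u).ncard := by
        rw [Set.ncard_range_of_injective hinj, Nat.card_eq_fintype_card, Fintype.card_fin]
    _ ≤ (G.neighborSet v).ncard :=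
        Set.ncard_le_ncard (by rintro _ ⟨i, rfl⟩; exact (hu i).adj_sub)

theorem genConn_three_le_of_maxDegree_ge_three (n : ℕ) (hn : 4 ≤ n)
    (M : Set (Sym2 (Fin n))) (hM : M ⊆ (⊤ : SimpleGraph (Fin n)).edgeSet)
    (hdeg : ∃ v : Fin n, 3 ≤ ((SimpleGraph.fromEdgeSet M).neighborSet v).ncard) :
    genConn ((⊤ : SimpleGraph (Fin n)).deleteEdges M) 3 ≤ n - 4 := by
  obtain ⟨v, hv⟩ := hdeg
  refine csSup_le' ?_
  rintro r ⟨-, hr⟩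
  obtain ⟨S, hvS, -, hS⟩ := Finset.exists_subsuperset_card_eq (n := 3)
    (Finset.subset_univ {v}) (by simp) (by simp; omega)
  obtain ⟨T, hT⟩ := hr S hS
  obtain ⟨w, hw, hwv⟩ := Finset.exists_mem_ne (by omega : 1 < S.card) v
  have hle := hT.le_ncard_neighborSet (by simpa using hvS) (Finset.mem_coe.mpr hw) hwv.symm
  set A := ((⊤ : SimpleGraph (Fin n)).deleteEdges M).neighborSet v
  set B := (fromEdgeSet M).neighborSet v
  have hAB : Disjoint A B := Set.disjoint_left.mpr fun x hA hB => by
    simp_all [A, B]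
  have hnot : v ∉ A ∪ B := by simp [A, B]
  have hcard := Set.ncard_le_card (insert v (A ∪ B))
  rw [Set.ncard_insert_of_notMem hnot, Set.ncard_union_eq hAB, Nat.card_eq_fintype_card,
    Fintype.card_fin] at hcard
  omega
end

section
/- For every n ≥ 3 and every edge e of the complete graph K_n, the graph K_n \ e obtained from K_n by deleting the single edge e satisfies κ_3(K_n \ e) = n − 2. -/
open SimpleGraph

namespace SimpleGraph.Subgraph

variable {V : Type*} {G : SimpleGraph V}

/-- A finite connected subgraph contains a tree with the same vertices. -/
theorem Connected.exists_isTree_le_verts_eq [Finite V] {H : G.Subgraph} (h : H.Connected) :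
    ∃ T ≤ H, T.verts = H.verts ∧ T.coe.IsTree := by
  obtain ⟨F, hFH, hF⟩ := h.coe.exists_isTree_le
  refine ⟨{ verts := H.verts
            Adj := fun u v => ∃ (hu : u ∈ H.verts) (hv : v ∈ H.verts), F.Adj ⟨u, hu⟩ ⟨v, hv⟩
            adj_sub := fun ⟨_, _, huv⟩ => H.adj_sub (hFH huv)
            edge_vert := fun ⟨hu, _, _⟩ => hu
            symm := ⟨fun _ _ ⟨hu, hv, huv⟩ => ⟨hv, hu, huv.symm⟩⟩ }, ?_, rfl, ?_⟩
  · exact ⟨subset_rfl, fun _ _ ⟨_, _, huv⟩ => hFH huv⟩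
  · convert hF
    ext u v
    simp

/-- The star centred at `c` with three leaves. -/
theorem exists_connected_star {c x y z : V} (hx : G.Adj c x) (hy : G.Adj c y) (hz : G.Adj c z) :
    ∃ H : G.Subgraph, H.Connected ∧ H.verts = {c, x, y, z} ∧
      H.edgeSet = {s(c, x), s(c, y), s(c, z)} := by
  refine ⟨G.subgraphOfAdj hx ⊔ G.subgraphOfAdj hy ⊔ G.subgraphOfAdj hz, ?_, ?_, ?_⟩
  · refine connected_sup (connected_sup ?_ ?_ ?_).preconnected ?_ ?_
    · exact (subgraphOfAdj_connected hx).preconnected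
    · exact (subgraphOfAdj_connected hy).preconnected
    · exact ⟨c, by simp⟩
    · exact (subgraphOfAdj_connected hz).preconnected
    · exact ⟨c, by simp⟩
  · ext; simp; tauto
  · ext; simp; tauto

/-- The path `x, y, c, z`. -/
theorem exists_connected_path {c x y z : V} (hx : G.Adj x y) (hy : G.Adj c y) (hz : G.Adj c z) :
    ∃ H : G.Subgraph, H.Connected ∧ H.verts = {c, x, y, z} ∧
      H.edgeSet = {s(x, y), s(c, y), s(c, z)} := by
  refine ⟨G.subgraphOfAdj hx ⊔ G.subgraphOfAdj hy ⊔ G.subgraphOfAdj hz, ?_, ?_, ?_⟩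
  · refine connected_sup (connected_sup ?_ ?_ ?_).preconnected ?_ ?_
    · exact (subgraphOfAdj_connected hx).preconnected
    · exact (subgraphOfAdj_connected hy).preconnected
    · exact ⟨y, by simp⟩
    · exact (subgraphOfAdj_connected hz).preconnected
    · exact ⟨c, by simp⟩
  · ext; simp; tauto
  · ext; simp; tauto

/-- The path `x, z, y`. -/
theorem exists_connected_path_three {x y z : V} (hx : G.Adj x z) (hy : G.Adj y z) :
    ∃ H : G.Subgraph, H.Connected ∧ H.verts = {x, y, z} ∧
      H.edgeSet = {s(x, z), s(y, z)} := by
  refine ⟨G.subgraphOfAdj hx ⊔ G.subgraphOfAdj hy, ?_, ?_, ?_⟩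
  · exact connected_sup (subgraphOfAdj_connected hx).preconnected
      (subgraphOfAdj_connected hy).preconnected ⟨z, by simp⟩
  · ext; simp; tauto
  · ext; simp; tauto

end SimpleGraph.Subgraph

section

variable {V : Type*} {G : SimpleGraph V}

/-- Connected subgraphs can be replaced by spanning trees when packing `S`-trees. -/
theorem exists_isInternallyDisjointSTrees_of_connected [Finite V] {S : Set V} {ι : Type*} {r : ℕ}
    (f : Fin r ≃ ι) (H : ι → G.Subgraph) (hH : ∀ i, S ⊆ (H i).verts ∧ (H i).Connected)
    (hd : Pairwise fun i j =>
      Disjoint (H i).edgeSet (H j).edgeSet ∧ (H i).verts ∩ (H j).verts = S) :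
    ∃ T : Fin r → G.Subgraph, IsInternallyDisjointSTrees G S T := by
  choose T hTle hTv hT using fun i => (hH i).2.exists_isTree_le_verts_eq
  refine ⟨fun i => T (f i), fun i => ⟨hTv _ ▸ (hH _).1, hT _⟩, fun i j hij => ?_⟩
  obtain ⟨h₁, h₂⟩ := hd (f.injective.ne hij)
  exact ⟨h₁.mono (Subgraph.edgeSet_mono (hTle _)) (Subgraph.edgeSet_mono (hTle _)),
    by rw [hTv, hTv, h₂]⟩

/-- If `x z y` is a path and every vertex outside `S = {x, y, z}` is adjacent to `y`, `z` and,
with at most one exception that is compensated by the edge `x y`, to `x`, then there are as many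
internally disjoint `S`-trees as vertices outside `S`, plus one. -/
theorem exists_isInternallyDisjointSTrees_triple [Fintype V] [DecidableEq V] {x y z w₀ : V}
    (hxy : x ≠ y) (hxz : G.Adj x z) (hyz : G.Adj y z)
    (hw : ∀ w ∉ ({x, y, z} : Finset V),
      G.Adj w y ∧ G.Adj w z ∧ (G.Adj w x ∨ w = w₀ ∧ G.Adj x y)) :
    ∃ T : Fin (Fintype.card V - 2) → G.Subgraph,
      IsInternallyDisjointSTrees G (({x, y, z} : Finset V) : Set V) T := by
  have hcard : ({x, y, z} : Finset V).card = 3 :=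
    Finset.card_eq_three.2 ⟨x, y, z, hxy, hxz.ne, hyz.ne, rfl⟩
  have hle := Finset.card_le_univ ({x, y, z} : Finset V)
  have hι : Fintype.card (Option {w // w ∉ ({x, y, z} : Finset V)}) = Fintype.card V - 2 := by
    rw [Fintype.card_option, Fintype.card_subtype_compl, Fintype.card_coe]
    omega
  have hex : ∀ w : {w // w ∉ ({x, y, z} : Finset V)}, ∃ H : G.Subgraph, H.Connected ∧
      H.verts = {w.1, x, y, z} ∧
      ∀ q ∈ H.edgeSet, w.1 ∈ q ∨ w.1 = w₀ ∧ q = s(x, y) := by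
    intro w
    obtain ⟨hy, hz, hx | ⟨h₀, hx⟩⟩ := hw w w.2
    · obtain ⟨H, hc, hv, he⟩ := Subgraph.exists_connected_star hx hy hz
      refine ⟨H, hc, hv, fun q hq => Or.inl ?_⟩
      rw [he] at hq
      rcases hq with rfl | rfl | rfl <;> simp
    · obtain ⟨H, hc, hv, he⟩ := Subgraph.exists_connected_path hx hy hz
      refine ⟨H, hc, hv, fun q hq => ?_⟩
      rw [he] at hq
      rcases hq with rfl | rfl | rfl <;> simp [h₀]
  choose A hAc hAv hAe using hex
  obtain ⟨B, hBc, hBv, hBe⟩ := Subgraph.exists_connected_path_three hxz hyz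
  have hAB : ∀ w, Disjoint (A w).edgeSet B.edgeSet ∧
      (A w).verts ∩ B.verts = (({x, y, z} : Finset V) : Set V) := by
    intro w
    have := w.2
    have h₁ := hxz.ne
    have h₂ := hyz.ne
    refine ⟨Set.disjoint_left.2 fun q hq hq' => ?_, ?_⟩
    · have := hAe w q hq
      rw [hBe] at hq'
      rcases hq' with rfl | rfl <;> simp at * <;> grind
    · rw [hAv, hBv]; ext; simp; tauto
  have hAA : ∀ v w, v ≠ w → Disjoint (A v).edgeSet (A w).edgeSet ∧
      (A v).verts ∩ (A w).verts = (({x, y, z} : Finset V) : Set V) := by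
    intro v w hvw
    have hv := v.2
    have hw' := w.2
    have hvw' : v.1 ≠ w.1 := Subtype.coe_injective.ne hvw
    refine ⟨Set.disjoint_left.2 fun q hq hq' => ?_, ?_⟩
    · rcases hAe v q hq with hvq | ⟨hv₀, -⟩
      · have := Subgraph.mem_verts_of_mem_edge hq' hvq
        rw [hAv] at this
        simp at this hv
        tauto
      rcases hAe w q hq' with hwq | ⟨hw₀, -⟩
      · have := Subgraph.mem_verts_of_mem_edge hq hwq
        rw [hAv] at this
        simp at this hw'
        grind
      exact hvw' (hv₀.trans hw₀.symm)
    · rw [hAv, hAv]; ext; simp; grind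
  refine exists_isInternallyDisjointSTrees_of_connected
    (Fintype.equivFinOfCardEq hι).symm (fun o => o.elim B A) ?_ ?_
  · rintro (_ | w)
    · exact ⟨by simp [hBv], hBc⟩
    · exact ⟨by simp [hAv], hAc w⟩
  · rintro (_ | v) (_ | w) h
    · exact absurd rfl h
    · exact ⟨(hAB w).1.symm, by rw [Set.inter_comm]; exact (hAB w).2⟩
    · exact hAB v
    · exact hAA v w fun h' => h (congrArg some h')

/-- The number of internally disjoint `S`-trees is at most the degree of any vertex of `S`. -/
theorem IsInternallyDisjointSTrees.le_degree [Fintype V] [DecidableRel G.Adj] {S : Set V}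
    (hS : S.Nontrivial) {r : ℕ} {T : Fin r → G.Subgraph}
    (hT : IsInternallyDisjointSTrees G S T) {v : V} (hv : v ∈ S) : r ≤ G.degree v := by
  have hex : ∀ i, ∃ u, (T i).Adj v u := by
    intro i
    have : Nontrivial (T i).verts := (hS.mono (hT.1 i).1).coe_sort
    obtain ⟨u, hu⟩ := (hT.1 i).2.1.preconnected.exists_adj_of_nontrivial
      ⟨v, (hT.1 i).1 hv⟩
    exact ⟨u, hu⟩
  choose u hu using hex
  have hinj : Function.Injective u := by
    intro i j hij
    by_contra hne
    exact Set.disjoint_left.1 (hT.2 hne).1 (Subgraph.mem_edgeSet.2 (hu i))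
      (Subgraph.mem_edgeSet.2 (hij ▸ hu j))
  rw [← card_neighborFinset_eq_degree]
  refine (Finset.card_fin r).ge.trans (Finset.card_le_card_of_injOn (s := Finset.univ) u
    (fun i _ => by simpa using (hu i).adj_sub) hinj.injOn)

/-- Deleting one edge from the complete graph on `n` vertices leaves `n - 2` internally disjoint
`S`-trees for every triple `S`. -/
theorem exists_isInternallyDisjointSTrees_top_deleteEdges [Fintype V] [DecidableEq V]
    (a b : V) {S : Finset V} (hS : S.card = 3) :
    ∃ T : Fin (Fintype.card V - 2) → ((⊤ : SimpleGraph V).deleteEdges {s(a, b)}).Subgraph,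
      IsInternallyDisjointSTrees _ (S : Set V) T := by
  have key : ∃ x y z w₀, S = {x, y, z} ∧ x ≠ y ∧ x ≠ z ∧ y ≠ z ∧ s(x, z) ≠ s(a, b) ∧
      s(y, z) ≠ s(a, b) ∧ ∀ w ∉ S, s(w, y) ≠ s(a, b) ∧ s(w, z) ≠ s(a, b) ∧
        (s(w, x) ≠ s(a, b) ∨ w = w₀ ∧ s(x, y) ≠ s(a, b)) := by
    have hlist : ∀ c ∈ S, ∃ y z, S = {c, y, z} ∧ c ≠ y ∧ c ≠ z ∧ y ≠ z := by
      intro c hc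
      obtain ⟨y, z, hyz, h⟩ := Finset.card_eq_two.1
        ((Finset.card_erase_of_mem hc).trans (by rw [hS]))
      have hc' := h ▸ Finset.notMem_erase c S
      simp only [Finset.mem_insert, Finset.mem_singleton, not_or] at hc'
      exact ⟨y, z, by rw [← h, Finset.insert_erase hc], hc'.1, hc'.2, hyz⟩
    simp only [ne_eq, Sym2.eq_iff]
    by_cases ha : a ∈ S <;> by_cases hb : b ∈ S
    · obtain ⟨y, z, rfl, h⟩ := hlist a ha
      by_cases hy : y = b
      · exact ⟨a, y, z, a, rfl, by grind⟩
      · exact ⟨a, z, y, a, by grind, by grind⟩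
    · obtain ⟨y, z, rfl, h⟩ := hlist a ha
      exact ⟨a, y, z, b, rfl, by grind⟩
    · obtain ⟨y, z, rfl, h⟩ := hlist b hb
      exact ⟨b, y, z, a, rfl, by grind⟩
    · obtain ⟨x, y, z, hxy, hxz, hyz, rfl⟩ := Finset.card_eq_three.1 hS
      exact ⟨x, y, z, a, rfl, by grind⟩
  obtain ⟨x, y, z, w₀, rfl, hxy, hxz, hyz, h₁, h₂, h⟩ := key
  refine exists_isInternallyDisjointSTrees_triple (w₀ := w₀) hxy (by simpa [hxz] using h₁)
    (by simpa [hyz] using h₂) fun w hw => ?_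
  have := h w hw
  simp only [Finset.mem_insert, Finset.mem_singleton, not_or] at hw
  simpa [hw, hxy] using this

end

theorem genConn_three_completeGraph_deleteEdge (n : ℕ) (hn : 3 ≤ n)
    (e : Sym2 (Fin n)) (he : e ∈ (⊤ : SimpleGraph (Fin n)).edgeSet) :
    genConn ((⊤ : SimpleGraph (Fin n)).deleteEdges {e}) 3 = n - 2 := by
  classical
  induction e with | h a b => ?_
  refine IsGreatest.csSup_eq ⟨⟨by omega, fun S hS => ?_⟩, ?_⟩
  · have h := exists_isInternallyDisjointSTrees_top_deleteEdges a b hS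
    rwa [Fintype.card_fin] at h
  · rintro r ⟨-, hr⟩
    obtain ⟨S, hSa, hS⟩ := Finset.exists_subsuperset_card_eq
      (Finset.subset_univ {a}) (n := 3) (by simp) (by simpa using hn)
    obtain ⟨T, hT⟩ := hr S hS.2
    have hle := hT.le_degree (Finset.one_lt_card_iff_nontrivial.1 (by omega)) (v := a)
      (by simpa using hSa)
    have hsub : ((⊤ : SimpleGraph (Fin n)).deleteEdges {s(a, b)}).neighborFinset a ⊆
        Finset.univ \ {a, b} := by
      intro v
      simp
      grind
    have hcard := Finset.card_le_card hsub
    rw [card_neighborFinset_eq_degree, Finset.card_sdiff_of_subset (Finset.subset_univ _),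
      Finset.card_pair (by simpa using he), Finset.card_univ, Fintype.card_fin] at hcard
    omega
end

section
/- Let n ≥ 4 and let G be the graph obtained from the complete graph K_n by deleting two distinct edges e_1 and e_2. Then κ_3(G) ≤ n − 3. -/
open SimpleGraph

/-- In a connected subgraph, a vertex that is not the only one has a neighbour. -/
theorem SimpleGraph.Subgraph.exists_adj_of_coe_preconnected {V : Type*} {G : SimpleGraph V}
    {T : G.Subgraph} (hT : T.coe.Preconnected) {x y : V} (hx : x ∈ T.verts) (hy : y ∈ T.verts)
    (hxy : x ≠ y) : ∃ z, T.Adj x z := by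
  obtain ⟨p⟩ := hT ⟨x, hx⟩ ⟨y, hy⟩
  cases p with
  | nil => exact absurd rfl hxy
  | cons h _ => exact ⟨_, h⟩

/-- If `G` misses the edges `ab` and `cd`, where `c ∉ {a, b}` and possibly `d ∈ {a, b}`, then
internally disjoint `{a, b, c}`-trees in `G` can be mapped injectively to the vertices outside
`{a, b, c}`. -/
theorem IsInternallyDisjointSTrees.le_card_sub_three {V : Type*} [Fintype V] [DecidableEq V]
    {G : SimpleGraph V} {a b c d : V} (hab : a ≠ b) (hac : a ≠ c) (hbc : b ≠ c) (hcd : c ≠ d)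
    (hGab : ¬ G.Adj a b) (hGcd : ¬ G.Adj c d) {r : ℕ} {T : Fin r → G.Subgraph}
    (hT : IsInternallyDisjointSTrees G (↑({a, b, c} : Finset V)) T) :
    r ≤ Fintype.card V - 3 := by
  obtain ⟨hS, hD⟩ := hT
  have ha i : a ∈ (T i).verts := (hS i).1 (by simp)
  have hb i : b ∈ (T i).verts := (hS i).1 (by simp)
  have hc i : c ∈ (T i).verts := (hS i).1 (by simp)
  have hpre i : (T i).coe.Preconnected := (hS i).2.connected.preconnected
  have hinter {i j x} (hij : i ≠ j) (hi : x ∈ (T i).verts) (hj : x ∈ (T j).verts) :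
      x = a ∨ x = b ∨ x = c := by
    have : x ∈ (T i).verts ∩ (T j).verts := ⟨hi, hj⟩
    rw [(hD hij).2] at this
    simpa using this
  have hedge {i j x y} (hij : i ≠ j) (hi : (T i).Adj x y) (hj : (T j).Adj x y) : False :=
    Set.disjoint_left.1 (hD hij).1 (Subgraph.mem_edgeSet.2 hi) (Subgraph.mem_edgeSet.2 hj)
  let small (i : Fin r) : Prop := ∀ x ∈ (T i).verts, x = a ∨ x = b ∨ x = c ∨ x = d
  have small_c {i} (h : small i) : (T i).Adj a c ∨ (T i).Adj b c := by
    obtain ⟨z, hz⟩ := Subgraph.exists_adj_of_coe_preconnected (hpre i) (hc i) (ha i) hac.symm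
    rcases h z hz.snd_mem with rfl | rfl | rfl | rfl
    · exact .inl hz.symm
    · exact .inr hz.symm
    · exact (hz.ne rfl).elim
    · exact (hGcd hz.adj_sub).elim
  have small_ab {i} (h : small i) (hd : d ∈ (T i).verts → d = a ∨ d = b ∨ d = c) :
      (T i).Adj a c ∧ (T i).Adj b c := by
    have h' : ∀ x ∈ (T i).verts, x = a ∨ x = b ∨ x = c := by
      intro x hx
      rcases h x hx with h | h | h | rfl
      exacts [.inl h, .inr (.inl h), .inr (.inr h), hd hx]
    constructor
    · obtain ⟨z, hz⟩ := Subgraph.exists_adj_of_coe_preconnected (hpre i) (ha i) (hb i) hab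
      rcases h' z hz.snd_mem with rfl | rfl | rfl
      exacts [(hz.ne rfl).elim, (hGab hz.adj_sub).elim, hz]
    · obtain ⟨z, hz⟩ := Subgraph.exists_adj_of_coe_preconnected (hpre i) (hb i) (ha i) hab.symm
      rcases h' z hz.snd_mem with rfl | rfl | rfl
      exacts [(hGab hz.symm.adj_sub).elim, (hz.ne rfl).elim, hz]
  have small_d {i} (h : small i) : d ≠ a ∧ d ≠ b ∧ d ≠ c := by
    refine ⟨?_, ?_, hcd.symm⟩
    · rintro rfl
      exact hGcd (small_ab h (by simp)).1.symm.adj_sub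
    · rintro rfl
      exact hGcd (small_ab h (by simp)).2.symm.adj_sub
  have small_unique {i j} (hi : small i) (hj : small j) : i = j := by
    by_contra hij
    by_cases hdi : d ∈ (T i).verts
    · have hj' := small_ab hj fun hdj => hinter hij hdi hdj
      rcases small_c hi with h | h
      exacts [hedge hij h hj'.1, hedge hij h hj'.2]
    · have hi' := small_ab hi fun h => (hdi h).elim
      rcases small_c hj with h | h
      exacts [hedge hij hi'.1 h, hedge hij hi'.2 h]
  have hex i : ∃ x, (x ≠ a ∧ x ≠ b ∧ x ≠ c) ∧
      ((x = d ∧ small i) ∨ (x ≠ d ∧ x ∈ (T i).verts)) := by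
    by_cases h : small i
    · exact ⟨d, small_d h, .inl ⟨rfl, h⟩⟩
    · simp only [small, not_forall, not_or] at h
      obtain ⟨x, hx, h1, h2, h3, h4⟩ := h
      exact ⟨x, ⟨h1, h2, h3⟩, .inr ⟨h4, hx⟩⟩
  choose f hf hfT using hex
  have hinj : Function.Injective f := by
    intro i j hij
    rcases hfT i with ⟨hi, hi'⟩ | ⟨hi, hi'⟩ <;> rcases hfT j with ⟨hj, hj'⟩ | ⟨hj, hj'⟩
    · exact small_unique hi' hj'
    · exact (hj (hij ▸ hi)).elim
    · exact (hi (hij ▸ hj)).elim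
    · by_contra hne
      have := hinter hne hi' (hij ▸ hj')
      have := hf i
      tauto
  calc r = (Finset.univ.image f).card := by simp [Finset.card_image_of_injective _ hinj]
    _ ≤ (({a, b, c} : Finset V)ᶜ).card := Finset.card_le_card fun x hx => by
        obtain ⟨i, -, rfl⟩ := Finset.mem_image.1 hx
        simpa using hf i
    _ = Fintype.card V - 3 := by
        rw [Finset.card_compl, Finset.card_eq_three.2 ⟨a, b, c, hab, hac, hbc, rfl⟩]

theorem genConn_three_completeGraph_deleteTwoEdges (n : ℕ) (hn : 4 ≤ n)
    (e₁ e₂ : Sym2 (Fin n)) (he₁ : e₁ ∈ (⊤ : SimpleGraph (Fin n)).edgeSet)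
    (he₂ : e₂ ∈ (⊤ : SimpleGraph (Fin n)).edgeSet) (hne : e₁ ≠ e₂) :
    genConn ((⊤ : SimpleGraph (Fin n)).deleteEdges {e₁, e₂}) 3 ≤ n - 3 := by
  obtain ⟨a, b, rfl⟩ : ∃ a b, e₁ = s(a, b) := by
    induction e₁ with | _ a b => exact ⟨a, b, rfl⟩
  obtain ⟨c, d, rfl, hac, hbc⟩ : ∃ c d, e₂ = s(c, d) ∧ a ≠ c ∧ b ≠ c := by
    induction e₂ with | _ c d =>
    by_cases h : a ≠ c ∧ b ≠ c
    · exact ⟨c, d, rfl, h⟩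
    · refine ⟨d, c, Sym2.eq_swap, ?_⟩
      simp only [mem_edgeSet, top_adj, ne_eq, Sym2.eq_iff] at he₁ he₂ hne
      grind
  refine csSup_le' ?_
  rintro r ⟨-, hr⟩
  obtain ⟨T, hT⟩ := hr {a, b, c} (Finset.card_eq_three.2 ⟨a, b, c, he₁, hac, hbc, rfl⟩)
  simpa using hT.le_card_sub_three he₁ hac hbc he₂ (by simp) (by simp)
end

section
/- Let G be a connected finite simple graph of order n with n ≥ 3. Then κ_3(G) = n − 2 if and only if G is the complete graph K_n or G is obtained from K_n by deleting exactly one edge. -/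
open SimpleGraph

namespace SimpleGraph.Subgraph

variable {V : Type*} {G : SimpleGraph V}

/-- A connected subgraph contains a tree on the same vertices. -/
lemma Connected.exists_isTree_le {H : G.Subgraph} (hH : H.Connected) :
    ∃ T : G.Subgraph, T ≤ H ∧ T.verts = H.verts ∧ T.coe.IsTree := by
  obtain ⟨F, hF, hT⟩ := hH.coe.exists_isTree_le
  let T : G.Subgraph :=
    { verts := H.verts
      Adj := fun u v => ∃ (hu : u ∈ H.verts) (hv : v ∈ H.verts), F.Adj ⟨u, hu⟩ ⟨v, hv⟩
      adj_sub := fun ⟨_, _, h⟩ => H.adj_sub (hF h)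
      edge_vert := fun ⟨hu, _, _⟩ => hu
      symm := ⟨fun _ _ ⟨hu, hv, h⟩ => ⟨hv, hu, h.symm⟩⟩ }
  have hTF : T.coe = F := by
    ext ⟨u, hu⟩ ⟨v, hv⟩
    exact ⟨fun ⟨_, _, h⟩ => h, fun h => ⟨hu, hv, h⟩⟩
  refine ⟨T, ⟨le_rfl, fun u v ⟨_, _, h⟩ => hF h⟩, rfl, ?_⟩
  rw [hTF]
  exact hT

lemma Connected.exists_adj {H : G.Subgraph} (hH : H.Connected) {a b : V} (ha : a ∈ H.verts)
    (hb : b ∈ H.verts) (hab : a ≠ b) : ∃ w, H.Adj a w := by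
  have : Nontrivial H.verts := ⟨⟨a, ha⟩, ⟨b, hb⟩, by simpa using hab⟩
  exact hH.preconnected.exists_adj_of_nontrivial ⟨a, ha⟩

lemma connected_sup_of_mem {H K : G.Subgraph} (hH : H.Connected) (hK : K.Connected) {x : V}
    (hxH : x ∈ H.verts) (hxK : x ∈ K.verts) : (H ⊔ K).Connected :=
  connected_sup hH.preconnected hK.preconnected ⟨x, hxH, hxK⟩

end SimpleGraph.Subgraph

section

variable {V : Type*} {G : SimpleGraph V}

/-- To find internally disjoint `S`-trees it suffices to find connected subgraphs. -/
lemma exists_isInternallyDisjointSTrees {ι : Type*} [Fintype ι] {r : ℕ}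
    (hr : Fintype.card ι = r) {S : Set V} (H : ι → G.Subgraph)
    (hS : ∀ i, S ⊆ (H i).verts) (hH : ∀ i, (H i).Connected)
    (hd : ∀ i j, i ≠ j →
      Disjoint (H i).edgeSet (H j).edgeSet ∧ (H i).verts ∩ (H j).verts = S) :
    ∃ T : Fin r → G.Subgraph, IsInternallyDisjointSTrees G S T := by
  choose T hle hv hT using fun i => (hH i).exists_isTree_le
  let e := (Fintype.equivFinOfCardEq hr).symm
  refine ⟨fun i => T (e i), fun i => ⟨by simpa [hv] using hS (e i), hT _⟩, fun i j hij => ?_⟩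
  obtain ⟨h₁, h₂⟩ := hd (e i) (e j) (e.injective.ne hij)
  refine ⟨h₁.mono (Subgraph.edgeSet_mono (hle _)) (Subgraph.edgeSet_mono (hle _)), ?_⟩
  simpa [hv] using h₂

/-- Internally disjoint trees for `{p, q, r}`: a path `q - p - r` together with, for each other
vertex `x`, a tree with `x` as its only further vertex, where one of those trees may also use
the edge `q r`. -/
lemma exists_isInternallyDisjointSTrees_of_path [Fintype V] {p q r d : V}
    (hpq : G.Adj p q) (hpr : G.Adj p r) (hqr : q ≠ r)
    (H : ∀ x : V, x ∉ ({p, q, r} : Set V) → ∃ K : G.Subgraph, K.Connected ∧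
      K.verts = insert x {p, q, r} ∧ ∀ e ∈ K.edgeSet, x ∈ e ∨ e = s(q, r) ∧ x = d) :
    ∃ T : Fin (Fintype.card V - 2) → G.Subgraph,
      IsInternallyDisjointSTrees G {p, q, r} T := by
  classical
  choose K hK hv he using H
  have hne₁ := hpq.ne
  have hne₂ := hpr.ne
  have hcard : Fintype.card (Option {x : V // x ∉ ({p, q, r} : Set V)}) =
      Fintype.card V - 2 := by
    have h₁ : Fintype.card {x : V // x ∈ ({p, q, r} : Finset V)} = 3 := by
      rw [Fintype.card_coe, Finset.card_eq_three]
      exact ⟨p, q, r, hne₁, hne₂, hqr, rfl⟩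
    have h₂ : Fintype.card {x : V // x ∉ ({p, q, r} : Set V)} = Fintype.card V - 3 := by
      rw [← h₁, ← Fintype.card_subtype_compl]
      exact Fintype.card_congr (Equiv.subtypeEquivRight (by simp))
    have h₃ : 3 ≤ Fintype.card V := h₁ ▸ Fintype.card_subtype_le _
    rw [Fintype.card_option, h₂]
    omega
  let P : G.Subgraph := G.subgraphOfAdj hpq ⊔ G.subgraphOfAdj hpr
  have hPv : P.verts = {p, q, r} := by
    ext z
    simp [P]
    tauto
  have hPe : ∀ e ∈ P.edgeSet, e = s(p, q) ∨ e = s(p, r) := by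
    intro e h
    simpa [P, or_comm] using h
  have hPK : ∀ x hx, Disjoint P.edgeSet (K x hx).edgeSet ∧
      P.verts ∩ (K x hx).verts = {p, q, r} := by
    refine fun x hx => ⟨?_, ?_⟩
    · rw [Set.disjoint_left]
      intro e h₁ h₂
      simp only [Set.mem_insert_iff, Set.mem_singleton_iff, not_or] at hx
      rcases hPe e h₁ with rfl | rfl <;> rcases he _ _ _ h₂ with h | ⟨h, -⟩ <;>
        simp at h <;> grind
    · rw [hPv, hv]
      exact Set.inter_eq_left.mpr (Set.subset_insert _ _)
  refine exists_isInternallyDisjointSTrees hcard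
    (fun o => o.elim P fun x => K x.1 x.2) ?_ ?_ ?_
  · rintro (_ | ⟨x, hx⟩)
    · exact hPv.ge
    · simp only [Option.elim_some, hv]
      exact Set.subset_insert _ _
  · rintro (_ | ⟨x, hx⟩)
    · exact Subgraph.connected_sup_of_mem (Subgraph.subgraphOfAdj_connected hpq)
        (Subgraph.subgraphOfAdj_connected hpr) (x := p) (by simp) (by simp)
    · exact hK x hx
  · rintro (_ | ⟨x, hx⟩) (_ | ⟨y, hy⟩) hij
    · exact absurd rfl hij
    · exact hPK y hy
    · exact ⟨(hPK x hx).1.symm, by rw [Set.inter_comm]; exact (hPK x hx).2⟩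
    · have hxy : x ≠ y := by simpa using hij
      simp only [Option.elim_some]
      have hmem : ∀ {z w} (hz : z ∉ ({p, q, r} : Set V)) {e : Sym2 V},
          e ∈ (K z hz).edgeSet → w ∈ e → w = z ∨ w ∈ ({p, q, r} : Set V) := by
        intro z w hz e h hw
        have := Subgraph.mem_verts_of_mem_edge h hw
        rwa [hv] at this
      refine ⟨?_, ?_⟩
      · rw [Set.disjoint_left]
        intro e h₁ h₂
        rcases he _ _ _ h₁ with h | ⟨-, h⟩
        · exact (hmem hy h₂ h).elim hxy hx
        · rcases he _ _ _ h₂ with h' | ⟨-, h'⟩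
          · exact (hmem hx h₁ h').elim hxy.symm hy
          · exact hxy (h.trans h'.symm)
      · rw [hv, hv]
        ext z
        simp only [Set.mem_inter_iff, Set.mem_insert_iff, Set.mem_singleton_iff]
        grind

/-- The star centred at `x` with leaves `p, q, r`. -/
lemma exists_connected_star {x p q r : V} (d : V) (hp : G.Adj x p) (hq : G.Adj x q)
    (hr : G.Adj x r) :
    ∃ K : G.Subgraph, K.Connected ∧
      K.verts = insert x {p, q, r} ∧ ∀ e ∈ K.edgeSet, x ∈ e ∨ e = s(q, r) ∧ x = d := by
  refine ⟨G.subgraphOfAdj hp ⊔ G.subgraphOfAdj hq ⊔ G.subgraphOfAdj hr, ?_, ?_, ?_⟩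
  · refine Subgraph.connected_sup_of_mem (x := x) (Subgraph.connected_sup_of_mem (x := x)
      ?_ ?_ ?_ ?_) ?_ ?_ ?_ <;>
      simp [Subgraph.subgraphOfAdj_connected]
  · ext z
    simp
    tauto
  · intro e he
    simp at he
    rcases he with rfl | rfl | rfl <;> simp

/-- The path `r - q - x - p`. -/
lemma exists_connected_path {x p q r : V} (hp : G.Adj x p) (hq : G.Adj x q) (hqr : G.Adj q r) :
    ∃ K : G.Subgraph, K.Connected ∧
      K.verts = insert x {p, q, r} ∧ ∀ e ∈ K.edgeSet, x ∈ e ∨ e = s(q, r) := by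
  refine ⟨G.subgraphOfAdj hp ⊔ G.subgraphOfAdj hq ⊔ G.subgraphOfAdj hqr, ?_, ?_, ?_⟩
  · refine Subgraph.connected_sup_of_mem (x := q) (Subgraph.connected_sup_of_mem (x := x)
      ?_ ?_ ?_ ?_) ?_ ?_ ?_ <;>
      simp [Subgraph.subgraphOfAdj_connected]
  · ext z
    simp
    tauto
  · intro e he
    simp at he
    rcases he with rfl | rfl | rfl <;> simp

/-- A graph missing at most the edge `u v` has `|V| - 2` internally disjoint trees for each
triple of vertices. -/
lemma exists_isInternallyDisjointSTrees_of_adj [Fintype V] {u v : V}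
    (hG : ∀ x y, x ≠ y → s(x, y) ≠ s(u, v) → G.Adj x y) (S : Finset V) (hS : S.card = 3) :
    ∃ T : Fin (Fintype.card V - 2) → G.Subgraph, IsInternallyDisjointSTrees G (↑S) T := by
  classical
  -- the missing edge joins a vertex of the triple to an outside vertex
  have mixed : ∀ {u v a b c : V}, (∀ x y, x ≠ y → s(x, y) ≠ s(u, v) → G.Adj x y) →
      a ≠ b → a ≠ c → b ≠ c → u = a → v ∉ ({a, b, c} : Set V) →
      ∃ T : Fin (Fintype.card V - 2) → G.Subgraph,
        IsInternallyDisjointSTrees G {a, b, c} T := by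
    rintro u v a b c hG hab hac hbc rfl hv
    have hset : ({u, b, c} : Set V) = {c, b, u} := by
      ext z
      simp only [Set.mem_insert_iff, Set.mem_singleton_iff]
      tauto
    rw [hset] at hv ⊢
    simp only [Set.mem_insert_iff, Set.mem_singleton_iff, not_or] at hv
    refine exists_isInternallyDisjointSTrees_of_path (d := v) (hG _ _ hbc.symm ?_)
      (hG _ _ hac.symm ?_) hab.symm ?_
    · simp only [ne_eq, Sym2.eq_iff]
      grind
    · simp only [ne_eq, Sym2.eq_iff]
      grind
    · intro x hx
      simp only [Set.mem_insert_iff, Set.mem_singleton_iff, not_or] at hx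
      by_cases hxv : x = v
      · subst hxv
        simp only [and_true]
        refine exists_connected_path (hG _ _ hx.1 ?_) (hG _ _ hx.2.1 ?_) (hG _ _ hab.symm ?_) <;>
          · simp only [ne_eq, Sym2.eq_iff]
            grind
      · refine exists_connected_star v (hG _ _ hx.1 ?_) (hG _ _ hx.2.1 ?_) (hG _ _ hx.2.2 ?_) <;>
          · simp only [ne_eq, Sym2.eq_iff]
            grind
  -- the missing edge is inside or outside the triple
  have unmixed : ∀ {a b c : V}, a ≠ b → a ≠ c → b ≠ c → s(a, b) ≠ s(u, v) → s(a, c) ≠ s(u, v) →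
      (u ∈ ({a, b, c} : Set V) ↔ v ∈ ({a, b, c} : Set V)) →
      ∃ T : Fin (Fintype.card V - 2) → G.Subgraph,
        IsInternallyDisjointSTrees G {a, b, c} T := by
    intro a b c hab hac hbc h₁ h₂ huv
    refine exists_isInternallyDisjointSTrees_of_path (d := a) (hG _ _ hab h₁) (hG _ _ hac h₂) hbc ?_
    intro x hx
    simp only [Set.mem_insert_iff, Set.mem_singleton_iff, not_or] at hx huv
    refine exists_connected_star a (hG _ _ hx.1 ?_) (hG _ _ hx.2.1 ?_) (hG _ _ hx.2.2 ?_) <;>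
      · simp only [ne_eq, Sym2.eq_iff]
        grind
  have hG' : ∀ x y, x ≠ y → s(x, y) ≠ s(v, u) → G.Adj x y := by
    simpa only [Sym2.eq_swap (a := v)] using hG
  obtain ⟨a, b, c, hab, hac, hbc, rfl⟩ := Finset.card_eq_three.mp hS
  push_cast
  have e₁ : ({a, b, c} : Set V) = {b, a, c} := Set.insert_comm _ _ _
  have e₂ : ({a, b, c} : Set V) = {c, a, b} := by
    rw [Set.pair_comm b c, Set.insert_comm]
  by_cases huv : u ∈ ({a, b, c} : Set V) ↔ v ∈ ({a, b, c} : Set V)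
  · by_cases h₁ : s(a, b) = s(u, v)
    · rw [e₂] at huv ⊢
      refine unmixed hac.symm hbc.symm hab ?_ ?_ huv <;>
        · rw [← h₁]
          simp only [ne_eq, Sym2.eq_iff]
          grind
    · by_cases h₂ : s(a, c) = s(u, v)
      · rw [e₁] at huv ⊢
        refine unmixed hab.symm hbc hac ?_ ?_ huv <;>
          · rw [← h₂]
            simp only [ne_eq, Sym2.eq_iff]
            grind
      · exact unmixed hab hac hbc h₁ h₂ huv
  · have key : ∀ {u v : V}, (∀ x y, x ≠ y → s(x, y) ≠ s(u, v) → G.Adj x y) →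
        u ∈ ({a, b, c} : Set V) → v ∉ ({a, b, c} : Set V) →
        ∃ T : Fin (Fintype.card V - 2) → G.Subgraph,
          IsInternallyDisjointSTrees G {a, b, c} T := by
      intro u v hG hu hv
      rcases hu with h | h | h
      · exact mixed hG hab hac hbc h hv
      · rw [e₁] at hv ⊢
        exact mixed hG hab.symm hbc hac h hv
      · rw [e₂] at hv ⊢
        exact mixed hG hac.symm hbc.symm hab h hv
    by_cases hu : u ∈ ({a, b, c} : Set V)
    · exact key hG hu (by tauto)
    · exact key hG' (by_contra fun hv => huv (iff_of_false hu hv)) hu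

namespace IsInternallyDisjointSTrees

variable {a b c : V} {r : ℕ} {T : Fin r → G.Subgraph}

lemma connected {S : Set V} (h : IsInternallyDisjointSTrees G S T) (i : Fin r) :
    (T i).Connected :=
  ⟨(h.1 i).2.connected⟩

lemma not_adj_of_adj {S : Set V} (h : IsInternallyDisjointSTrees G S T) {i j : Fin r}
    (hij : i ≠ j) {x y : V} (hi : (T i).Adj x y) : ¬ (T j).Adj x y := fun hj =>
  Set.disjoint_left.mp (h.2 hij).1 (Subgraph.mem_edgeSet.mpr hi) (Subgraph.mem_edgeSet.mpr hj)

lemma adj_or_adj {S : Set V} (h : IsInternallyDisjointSTrees G S T) (hS : S = {a, b, c})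
    (hab : a ≠ b) {i : Fin r} (hi : (T i).verts = S) : (T i).Adj a b ∨ (T i).Adj a c := by
  obtain ⟨w, hw⟩ := (h.connected i).exists_adj (a := a) (b := b)
    (by simp [hi, hS]) (by simp [hi, hS]) hab
  have hwv := hw.snd_mem
  rw [hi, hS] at hwv
  rcases hwv with rfl | rfl | rfl
  · exact absurd rfl hw.ne
  · exact .inl hw
  · exact .inr hw

lemma adj_triple (h : IsInternallyDisjointSTrees G {a, b, c} T) (hab : a ≠ b) (hac : a ≠ c)
    {i : Fin r} (hi : (T i).verts = {a, b, c}) :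
    ((T i).Adj a b ∨ (T i).Adj a c) ∧ ((T i).Adj a b ∨ (T i).Adj b c) ∧
      ((T i).Adj a c ∨ (T i).Adj b c) := by
  refine ⟨h.adj_or_adj rfl hab hi, ?_, ?_⟩
  · have := h.adj_or_adj (a := b) (b := a) (c := c) (Set.insert_comm _ _ _) hab.symm hi
    rwa [(T i).adj_comm b a] at this
  · have := h.adj_or_adj (a := c) (b := a) (c := b)
      (by rw [Set.pair_comm b c, Set.insert_comm]) hac.symm hi
    rwa [(T i).adj_comm c a, (T i).adj_comm c b] at this

lemma eq_of_verts_eq (h : IsInternallyDisjointSTrees G {a, b, c} T) (hab : a ≠ b) (hac : a ≠ c)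
    {i j : Fin r} (hi : (T i).verts = {a, b, c}) (hj : (T j).verts = {a, b, c}) : i = j := by
  by_contra hij
  have := h.adj_triple hab hac hi
  have := h.adj_triple hab hac hj
  have := h.not_adj_of_adj hij (x := a) (y := b)
  have := h.not_adj_of_adj hij (x := a) (y := c)
  have := h.not_adj_of_adj hij (x := b) (y := c)
  tauto

/-- At most `|V| - 2` trees are internally disjoint, with equality only if one tree lives on the
triple and the others have exactly one further vertex each. -/
lemma add_two_le_card [Fintype V] (h : IsInternallyDisjointSTrees G {a, b, c} T)
    (hab : a ≠ b) (hac : a ≠ c) (hbc : b ≠ c) :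
    r + 2 ≤ Fintype.card V ∧ (r + 2 = Fintype.card V →
      (∃ i, (T i).verts = {a, b, c}) ∧
      ∀ x ∉ ({a, b, c} : Set V), ∃ i, (T i).verts = insert x {a, b, c}) := by
  classical
  have hex : ∀ i, ∃ x, (T i).verts ≠ {a, b, c} → x ∉ ({a, b, c} : Set V) ∧ x ∈ (T i).verts := by
    intro i
    by_cases hi : (T i).verts = {a, b, c}
    · exact ⟨a, fun h => absurd hi h⟩
    · obtain ⟨x, hx, hx'⟩ := Set.exists_of_ssubset (lt_of_le_of_ne (h.1 i).1 (Ne.symm hi))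
      exact ⟨x, fun _ => ⟨hx', hx⟩⟩
  choose f hf using hex
  have hinj : ∀ i j x, x ∉ ({a, b, c} : Set V) → x ∈ (T i).verts → x ∈ (T j).verts → i = j := by
    intro i j x hx hi hj
    by_contra hij
    exact hx ((h.2 hij).2 ▸ ⟨hi, hj⟩)
  let A : Finset (Fin r) := {i | (T i).verts ≠ {a, b, c}}
  let B : Finset (Fin r) := {i | ¬ (T i).verts ≠ {a, b, c}}
  have hAB : A.card + B.card = r :=
    (Finset.card_filter_add_card_filter_not _).trans (Finset.card_fin r)
  have hB : B.card ≤ 1 := by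
    rw [Finset.card_le_one]
    intro i hi j hj
    simp only [B, Finset.mem_filter, Finset.mem_univ, true_and, not_not] at hi hj
    exact h.eq_of_verts_eq hab hac hi hj
  let S : Finset V := {a, b, c}
  have hS : S.card = 3 := Finset.card_eq_three.mpr ⟨a, b, c, hab, hac, hbc, rfl⟩
  have hSmem : ∀ x, x ∈ Sᶜ ↔ x ∉ ({a, b, c} : Set V) := by simp [S]
  have hSc : Sᶜ.card + 3 = Fintype.card V := by
    rw [← hS, Finset.card_compl_add_card]
  have hAf : ∀ i ∈ A, f i ∉ ({a, b, c} : Set V) ∧ f i ∈ (T i).verts := fun i hi =>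
    hf i (by simpa [A] using hi)
  have himg : A.image f ⊆ Sᶜ := by
    intro x hx
    obtain ⟨i, hi, rfl⟩ := Finset.mem_image.mp hx
    exact (hSmem _).mpr (hAf i hi).1
  have hcardimg : (A.image f).card = A.card := by
    refine Finset.card_image_of_injOn fun i hi j hj hij => ?_
    exact hinj i j (f i) (hAf i hi).1 (hAf i hi).2 (hij ▸ (hAf j hj).2)
  have hA := Finset.card_le_card himg
  refine ⟨by omega, fun hr => ⟨?_, fun x hx => ?_⟩⟩
  · obtain ⟨i, hi⟩ := Finset.card_pos.mp (show 0 < B.card by omega)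
    exact ⟨i, by simpa [B] using hi⟩
  · have heq : A.image f = Sᶜ := Finset.eq_of_subset_of_card_le himg (by omega)
    have hxi := (hSmem x).mpr hx
    rw [← heq] at hxi
    obtain ⟨i, hi, rfl⟩ := Finset.mem_image.mp hxi
    refine ⟨i, subset_antisymm (fun y hy => ?_) (Set.insert_subset (hAf i hi).2 (h.1 i).1)⟩
    by_cases hyS : y ∈ ({a, b, c} : Set V)
    · exact .inr hyS
    · have hyj := (hSmem y).mpr hyS
      rw [← heq] at hyj
      obtain ⟨j, hj, rfl⟩ := Finset.mem_image.mp hyj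
      rw [hinj i j _ hyS hy (hAf j hj).2]
      exact .inl rfl

/-- With `|V| - 2` internally disjoint trees for `{a, b, c}`, at most one edge is missing inside
`{a, b, c}`, and if that is `a b` then `c` is adjacent to every vertex outside. -/
lemma adj_of_add_two_eq_card [Fintype V] (h : IsInternallyDisjointSTrees G {a, b, c} T)
    (hab : a ≠ b) (hac : a ≠ c) (hbc : b ≠ c) (hr : r + 2 = Fintype.card V)
    (hadj : ¬ G.Adj a b) :
    G.Adj a c ∧ ∀ d ∉ ({a, b, c} : Set V), G.Adj c d := by
  obtain ⟨⟨i, hi⟩, hx⟩ := (h.add_two_le_card hab hac hbc).2 hr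
  have hiab : ¬ (T i).Adj a b := fun h' => hadj h'.adj_sub
  obtain ⟨h₁, h₂, -⟩ := h.adj_triple hab hac hi
  have hiac := h₁.resolve_left hiab
  have hibc := h₂.resolve_left hiab
  refine ⟨hiac.adj_sub, fun d hd => ?_⟩
  obtain ⟨j, hj⟩ := hx d hd
  have hij : i ≠ j := by
    rintro rfl
    rw [hi] at hj
    exact hd (hj ▸ Set.mem_insert _ _)
  obtain ⟨w, hw⟩ := (h.connected j).exists_adj (a := c) (b := a)
    (by simp [hj]) (by simp [hj]) hac.symm
  have hwv := hw.snd_mem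
  rw [hj] at hwv
  rcases hwv with rfl | rfl | rfl | rfl
  · exact hw.adj_sub
  · exact absurd hw.symm (h.not_adj_of_adj hij hiac)
  · exact absurd hw.symm (h.not_adj_of_adj hij hibc)
  · exact absurd rfl hw.ne

end IsInternallyDisjointSTrees

lemma genConn_three_eq_iff [Fintype V] (hV : 3 ≤ Fintype.card V) :
    genConn G 3 = Fintype.card V - 2 ↔ ∀ S : Finset V, S.card = 3 →
      ∃ T : Fin (Fintype.card V - 2) → G.Subgraph, IsInternallyDisjointSTrees G (↑S) T := by
  classical
  set R := {r : ℕ | 0 < r ∧ ∀ S : Finset V, S.card = 3 →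
    ∃ T : Fin r → G.Subgraph, IsInternallyDisjointSTrees G (↑S) T}
  have hle : ∀ r ∈ R, r ≤ Fintype.card V - 2 := by
    rintro r ⟨-, hr⟩
    obtain ⟨S, -, hS⟩ := Finset.exists_subset_card_eq (s := (Finset.univ : Finset V)) hV
    obtain ⟨T, hT⟩ := hr S hS
    obtain ⟨a, b, c, hab, hac, hbc, rfl⟩ := Finset.card_eq_three.mp hS
    push_cast at hT
    have := (hT.add_two_le_card hab hac hbc).1
    omega
  have hbdd : BddAbove R := ⟨_, hle⟩
  change sSup R = _ ↔ _
  constructor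
  · intro h
    have hne : R.Nonempty := by
      by_contra hne
      rw [Set.not_nonempty_iff_eq_empty.mp hne, csSup_empty, Nat.bot_eq_zero] at h
      omega
    exact (h ▸ Nat.sSup_mem hne hbdd).2
  · intro h
    exact IsGreatest.csSup_eq ⟨⟨by omega, h⟩, hle⟩

end

theorem genConn_three_eq_sub_two_iff {V : Type*} [Fintype V] (G : SimpleGraph V) (n : ℕ)
    (hcard : Fintype.card V = n) (hn : 3 ≤ n) (hG : G.Connected) :
    genConn G 3 = n - 2 ↔
      G = (⊤ : SimpleGraph V) ∨
        ∃ e ∈ (⊤ : SimpleGraph V).edgeSet, G = (⊤ : SimpleGraph V).deleteEdges {e} := by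
  classical
  subst hcard
  rw [genConn_three_eq_iff hn]
  constructor
  · intro h
    have key : ∀ a b c : V, a ≠ b → a ≠ c → b ≠ c → ¬ G.Adj a b →
        G.Adj a c ∧ ∀ d ∉ ({a, b, c} : Set V), G.Adj c d := by
      intro a b c hab hac hbc hadj
      obtain ⟨T, hT⟩ := h {a, b, c} (Finset.card_eq_three.mpr ⟨a, b, c, hab, hac, hbc, rfl⟩)
      push_cast at hT
      exact hT.adj_of_add_two_eq_card hab hac hbc (by omega) hadj
    refine or_iff_not_imp_left.mpr fun hne => ?_
    obtain ⟨a, b, hab, hadj⟩ : ∃ a b : V, a ≠ b ∧ ¬ G.Adj a b := by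
      by_contra! hall
      exact hne (eq_top_iff.mpr fun a b hab => hall a b hab)
    refine ⟨s(a, b), hab, ?_⟩
    ext x y
    simp only [deleteEdges_adj, top_adj, Set.mem_singleton_iff]
    constructor
    · intro hxy
      refine ⟨hxy.ne, fun heq => hadj ?_⟩
      rwa [← mem_edgeSet, ← heq, mem_edgeSet]
    · rintro ⟨hxy, hs⟩
      simp only [Sym2.eq_iff, not_or, not_and] at hs
      have hadj' : ¬ G.Adj b a := fun h => hadj h.symm
      have ha : ∀ z, z ≠ a → z ≠ b → G.Adj a z := fun z h₁ h₂ =>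
        (key a b z hab h₁.symm h₂.symm hadj).1
      have hb : ∀ z, z ≠ a → z ≠ b → G.Adj b z := fun z h₁ h₂ =>
        (key b a z hab.symm h₂.symm h₁.symm hadj').1
      by_cases hxa : x = a
      · subst hxa
        exact ha y hxy.symm (hs.1 rfl)
      by_cases hxb : x = b
      · subst hxb
        exact hb y (hs.2 rfl) hxy.symm
      by_cases hya : y = a
      · subst hya
        exact (ha x hxa hxb).symm
      by_cases hyb : y = b
      · subst hyb
        exact (hb x hxa hxb).symm
      refine (key a b x hab (Ne.symm hxa) (Ne.symm hxb) hadj).2 y ?_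
      simp only [Set.mem_insert_iff, Set.mem_singleton_iff, not_or]
      exact ⟨hya, hyb, hxy.symm⟩
  · rintro (rfl | ⟨e, -, rfl⟩)
    · obtain ⟨v⟩ := hG.nonempty
      exact exists_isInternallyDisjointSTrees_of_adj (u := v) (v := v) fun x y hxy _ => hxy
    · induction e with
      | _ u v =>
        exact exists_isInternallyDisjointSTrees_of_adj (u := u) (v := v) fun x y hxy hs => by
          simpa using ⟨hxy, by simpa using hs⟩
end

section
/- Let G be obtained from the complete graph K_n by deleting an edge set M. If the subgraph K_n[M] induced by the edges of M has two distinct connected components, each of which is a path or a cycle on at least 3 vertices, then κ_3(G) ≤ n − 4. -/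
open SimpleGraph

/-- The connected component `c` of `H` is (isomorphic to) a path on `k` vertices. -/
def CompIsPathOn {V : Type*} (H : SimpleGraph V) (c : H.ConnectedComponent) (k : ℕ) : Prop :=
  Nonempty (H.induce c.supp ≃g pathGraph k)

/-- The connected component `c` of `H` is (isomorphic to) a cycle on `k` vertices. -/
def CompIsCycleOn {V : Type*} (H : SimpleGraph V) (c : H.ConnectedComponent) (k : ℕ) : Prop :=
  Nonempty (H.induce c.supp ≃g cycleGraph k)

/-- If there are at least `deg u` internally disjoint `S`-trees and `u ∈ S`, then every edge
at `u` lies in one of the trees, and every tree has exactly one edge at `u`. -/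
theorem IsInternallyDisjointSTrees.adj_of_degree_le {V : Type*} [Fintype V]
    {G : SimpleGraph V} [DecidableRel G.Adj] {S : Set V} {r : ℕ} {T : Fin r → G.Subgraph}
    (hT : IsInternallyDisjointSTrees G S T) {u x : V} (hu : u ∈ S) (hx : x ∈ S) (hux : u ≠ x)
    (hdeg : G.degree u ≤ r) :
    (∀ a, G.Adj u a → ∃ i, (T i).Adj u a) ∧
      ∀ i a b, (T i).Adj u a → (T i).Adj u b → a = b := by
  have hnbr : ∀ i, ∃ a, (T i).Adj u a := by
    intro i
    have hne : (⟨u, (hT.1 i).1 hu⟩ : (T i).verts) ≠ ⟨x, (hT.1 i).1 hx⟩ := by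
      simpa using hux
    have : Nontrivial (T i).verts := ⟨_, _, hne⟩
    obtain ⟨a, ha⟩ := (hT.1 i).2.connected.preconnected.exists_adj_of_nontrivial
      ⟨u, (hT.1 i).1 hu⟩
    exact ⟨a, ha⟩
  choose w hw using hnbr
  have huniq : ∀ i j a, (T i).Adj u a → (T j).Adj u a → i = j := by
    intro i j a hi hj
    by_contra hij
    exact Set.disjoint_left.mp (hT.2 hij).1 (Subgraph.mem_edgeSet.mpr hi)
      (Subgraph.mem_edgeSet.mpr hj)
  let f : Fin r → G.neighborSet u := fun i => ⟨w i, (hw i).adj_sub⟩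
  have hf : Function.Injective f := by
    intro i j hij
    have hwij : w i = w j := congrArg Subtype.val hij
    exact huniq i j (w i) (hw i) (hwij ▸ hw j)
  have hsurj : Function.Surjective f := by
    refine ((Fintype.bijective_iff_injective_and_card f).mpr ⟨hf, le_antisymm
      (Fintype.card_le_of_injective f hf) ?_⟩).2
    rwa [Fintype.card_fin, card_neighborSet_eq_degree]
  have hrange : ∀ a, G.Adj u a → ∃ i, w i = a := by
    intro a ha
    obtain ⟨i, hi⟩ := hsurj ⟨a, ha⟩
    exact ⟨i, congrArg Subtype.val hi⟩
  have heq : ∀ i a, (T i).Adj u a → a = w i := by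
    intro i a ha
    obtain ⟨j, rfl⟩ := hrange a ha.adj_sub
    rw [huniq i j _ ha (hw j)]
  refine ⟨fun a ha => ?_, fun i a b ha hb => (heq i a ha).trans (heq i b hb).symm⟩
  obtain ⟨i, rfl⟩ := hrange a ha
  exact ⟨i, hw i⟩

/-- If `S` contains two adjacent vertices `u`, `v` and a further vertex, then the number of
internally disjoint `S`-trees is less than the larger of the degrees of `u` and `v`. -/
theorem IsInternallyDisjointSTrees.lt_max_degree {V : Type*} [Fintype V]
    {G : SimpleGraph V} [DecidableRel G.Adj] {S : Set V} {r : ℕ} {T : Fin r → G.Subgraph}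
    (hT : IsInternallyDisjointSTrees G S T) {u v x : V} (hu : u ∈ S) (hv : v ∈ S) (hx : x ∈ S)
    (hxu : x ≠ u) (hxv : x ≠ v) (huv : G.Adj u v) :
    r < max (G.degree u) (G.degree v) := by
  by_contra! hr
  obtain ⟨hcov, huniq_u⟩ :=
    hT.adj_of_degree_le hu hx hxu.symm ((le_max_left _ _).trans hr)
  have huniq_v := (hT.adj_of_degree_le hv hx hxv.symm ((le_max_right _ _).trans hr)).2
  obtain ⟨i, hi⟩ := hcov v huv
  have hstay : ∀ a b : (T i).verts, (T i).coe.Walk a b →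
      (a.1 = u ∨ a.1 = v) → (b.1 = u ∨ b.1 = v) := by
    intro a b p
    induction p with
    | nil => exact id
    | @cons a b _ h _ ih =>
      have hab : (T i).Adj a.1 b.1 := h
      rintro (ha | ha)
      · exact ih (Or.inr (huniq_u i _ _ (ha ▸ hab) hi))
      · exact ih (Or.inl (huniq_v i _ _ (ha ▸ hab) hi.symm))
  obtain ⟨p⟩ := (hT.1 i).2.connected.preconnected ⟨u, (hT.1 i).1 hu⟩ ⟨x, (hT.1 i).1 hx⟩
  exact (hstay _ _ p (Or.inl rfl)).elim hxu hxv

/-- A component that is a path or a cycle on at least three vertices has a vertex with two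
distinct neighbours. -/
theorem exists_two_neighbors_of_path_or_cycle {V : Type*} {H : SimpleGraph V}
    {c : H.ConnectedComponent} (h : ∃ k, 3 ≤ k ∧ (CompIsPathOn H c k ∨ CompIsCycleOn H c k)) :
    ∃ v ∈ c.supp, ∃ a b, a ≠ b ∧ H.Adj v a ∧ H.Adj v b := by
  obtain ⟨k, hk, h⟩ := h
  obtain ⟨K, hK, ⟨e⟩⟩ : ∃ K : SimpleGraph (Fin k), pathGraph k ≤ K ∧
      Nonempty (H.induce c.supp ≃g K) :=
    h.elim (fun h => ⟨_, le_rfl, h⟩) (fun h => ⟨_, pathGraph_le_cycleGraph, h⟩)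
  have h10 : K.Adj ⟨1, by omega⟩ ⟨0, by omega⟩ := hK (by simp [pathGraph_adj])
  have h12 : K.Adj ⟨1, by omega⟩ ⟨2, by omega⟩ := hK (by simp [pathGraph_adj])
  refine ⟨_, (e.symm ⟨1, by omega⟩).2, e.symm ⟨0, by omega⟩, e.symm ⟨2, by omega⟩, ?_,
    e.symm.map_adj_iff.mpr h10, e.symm.map_adj_iff.mpr h12⟩
  intro hab
  simpa using e.symm.injective (Subtype.ext hab)

/-- A vertex with two distinct neighbours in the graph on the edge set `M` has degree at most
`n - 3` in `K_n \ M`. -/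
theorem degree_deleteEdges_le_of_two_neighbors {V : Type*} [Fintype V] {M : Set (Sym2 V)}
    [DecidableRel ((⊤ : SimpleGraph V).deleteEdges M).Adj] {v a b : V} (hab : a ≠ b)
    (ha : (fromEdgeSet M).Adj v a) (hb : (fromEdgeSet M).Adj v b) :
    ((⊤ : SimpleGraph V).deleteEdges M).degree v ≤ Fintype.card V - 3 := by
  classical
  have hcard : ({v, a, b} : Finset V).card = 3 :=
    Finset.card_eq_three.mpr ⟨v, a, b, ha.ne, hb.ne, hab, rfl⟩
  rw [← hcard, ← Finset.card_compl, ← card_neighborFinset_eq_degree]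
  refine Finset.card_le_card fun x hx => ?_
  rw [mem_neighborFinset, deleteEdges_adj] at hx
  rw [fromEdgeSet_adj] at ha hb
  simp only [Finset.mem_compl, Finset.mem_insert, Finset.mem_singleton]
  rintro (rfl | rfl | rfl)
  · exact hx.1.ne rfl
  · exact hx.2 ha.1
  · exact hx.2 hb.1

theorem genConn_three_le_of_two_big_components (n : ℕ) (M : Set (Sym2 (Fin n)))
    (hM : M ⊆ (⊤ : SimpleGraph (Fin n)).edgeSet)
    (hcomp : ∃ c₁ c₂ : (SimpleGraph.fromEdgeSet M).ConnectedComponent, c₁ ≠ c₂ ∧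
      (∃ k, 3 ≤ k ∧ (CompIsPathOn (SimpleGraph.fromEdgeSet M) c₁ k ∨
        CompIsCycleOn (SimpleGraph.fromEdgeSet M) c₁ k)) ∧
      (∃ k, 3 ≤ k ∧ (CompIsPathOn (SimpleGraph.fromEdgeSet M) c₂ k ∨
        CompIsCycleOn (SimpleGraph.fromEdgeSet M) c₂ k))) :
    genConn ((⊤ : SimpleGraph (Fin n)).deleteEdges M) 3 ≤ n - 4 := by
  classical
  obtain ⟨c₁, c₂, hne, h₁, h₂⟩ := hcomp
  obtain ⟨u, hu, a, b, hab, hua, hub⟩ := exists_two_neighbors_of_path_or_cycle h₁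
  obtain ⟨v, hv, d, e, hde, hvd, hve⟩ := exists_two_neighbors_of_path_or_cycle h₂
  have hdu := degree_deleteEdges_le_of_two_neighbors hab hua hub
  have hdv := degree_deleteEdges_le_of_two_neighbors hde hvd hve
  rw [Fintype.card_fin] at hdu hdv
  rw [ConnectedComponent.mem_supp_iff] at hu hv
  have hnr : ¬ (fromEdgeSet M).Reachable u v := fun h =>
    hne (hu.symm.trans ((ConnectedComponent.sound h).trans hv))
  have huv : u ≠ v := fun h => hnr (h ▸ Reachable.refl u)
  have hav : a ≠ v := fun h => hnr (h ▸ hua.reachable)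
  have hadj : ((⊤ : SimpleGraph (Fin n)).deleteEdges M).Adj u v := by
    rw [deleteEdges_adj]
    exact ⟨huv, fun h => hnr (Adj.reachable ((fromEdgeSet_adj M).mpr ⟨h, huv⟩))⟩
  refine csSup_le' ?_
  rintro r ⟨-, hS⟩
  obtain ⟨T, hT⟩ := hS {u, v, a} (Finset.card_eq_three.mpr ⟨u, v, a, huv, hua.ne, hav.symm, rfl⟩)
  have hlt := hT.lt_max_degree (u := u) (v := v) (x := a) (by simp) (by simp) (by simp)
    hua.ne' hav hadj
  omega
end

section
/- Let G be obtained from the complete graph K_n by deleting an edge set M. If some connected component of the subgraph K_n[M] induced by the edges of M is a path or a cycle on at least 5 vertices, then κ_3(G) ≤ n − 4. -/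
open SimpleGraph

/-- In a subgraph that is a tree, a vertex distinct from some other vertex has a neighbor. -/
theorem exists_adj_of_isTree_coe {V : Type*} {G : SimpleGraph V} {T : G.Subgraph}
    (hT : T.coe.IsTree) {u v : V} (hu : u ∈ T.verts) (hv : v ∈ T.verts) (huv : u ≠ v) :
    ∃ w, T.Adj u w := by
  obtain ⟨q⟩ := hT.connected.preconnected ⟨u, hu⟩ ⟨v, hv⟩
  cases q with
  | nil => exact absurd rfl huv
  | cons h _ => exact ⟨_, h⟩

/-- A component that is a path or a cycle on at least five vertices contains five distinct
consecutive vertices. -/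
theorem exists_injective_consecutive {V : Type*} {H : SimpleGraph V}
    {c : H.ConnectedComponent} {k : ℕ} (hk : 5 ≤ k)
    (hc : CompIsPathOn H c k ∨ CompIsCycleOn H c k) :
    ∃ p : Fin 5 → V, Function.Injective p ∧
      ∀ i j : Fin 5, i.val + 1 = j.val → H.Adj (p i) (p j) := by
  obtain ⟨K, hK, ⟨e⟩⟩ : ∃ K : SimpleGraph (Fin k), pathGraph k ≤ K ∧
      Nonempty (H.induce c.supp ≃g K) := by
    rcases hc with h | h
    · exact ⟨_, le_rfl, h⟩
    · exact ⟨_, pathGraph_le_cycleGraph, h⟩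
  refine ⟨fun i => (e.symm (Fin.castLE hk i)).val, fun i j hij => ?_, fun i j hij => ?_⟩
  · exact Fin.castLE_injective hk (e.symm.injective (Subtype.ext hij))
  · have hadj : K.Adj (Fin.castLE hk i) (Fin.castLE hk j) :=
      hK (pathGraph_adj.mpr (Or.inl hij))
    exact (e.symm.map_rel_iff.mpr hadj :)

/-- A path on four consecutive edges `a b`, `b c`, `c d`, `d e` missing from `G` forces any family
of internally disjoint `{b, c, d}`-trees to have at most `n - 4` members. -/
theorem card_le_of_isInternallyDisjointSTrees {V : Type*} [Fintype V] [DecidableEq V]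
    {G : SimpleGraph V} {p : Fin 5 → V} (hp : Function.Injective p)
    (h01 : ¬ G.Adj (p 0) (p 1)) (h12 : ¬ G.Adj (p 1) (p 2))
    (h23 : ¬ G.Adj (p 2) (p 3)) (h34 : ¬ G.Adj (p 3) (p 4)) {r : ℕ}
    {T : Fin r → G.Subgraph}
    (hT : IsInternallyDisjointSTrees G (({p 1, p 2, p 3} : Finset V) : Set V) T) :
    r ≤ Fintype.card V - 4 := by
  obtain ⟨hS, hd⟩ := hT
  have hne : ∀ {a b : Fin 5}, a ≠ b → p a ≠ p b := fun h => hp.ne h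
  have h1 : ∀ i, p 1 ∈ (T i).verts := fun i => (hS i).1 (by simp)
  have h2 : ∀ i, p 2 ∈ (T i).verts := fun i => (hS i).1 (by simp)
  have h3 : ∀ i, p 3 ∈ (T i).verts := fun i => (hS i).1 (by simp)
  have hout : ∀ i, ∃ v ∈ (T i).verts, v ∉ ({p 1, p 2, p 3} : Finset V) := by
    intro i
    obtain ⟨w, hw⟩ := exists_adj_of_isTree_coe (hS i).2 (h2 i) (h1 i) (hne (by decide))
    refine ⟨w, hw.snd_mem, ?_⟩
    have hG := hw.adj_sub
    simp only [Finset.mem_insert, Finset.mem_singleton]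
    rintro (rfl | rfl | rfl)
    · exact h12 hG.symm
    · exact G.irrefl hG
    · exact h23 hG
  choose f hfT hfS using hout
  have huniq : ∀ {i j v}, v ∈ (T i).verts → v ∈ (T j).verts →
      v ∉ ({p 1, p 2, p 3} : Finset V) → i = j := by
    intro i j v hi hj hv
    by_contra hij
    have hmem : v ∈ (T i).verts ∩ (T j).verts := ⟨hi, hj⟩
    rw [(hd hij).2] at hmem
    exact hv hmem
  have hinj : Function.Injective f := fun i j hij =>
    huniq (hfT i) (hij ▸ hfT j) (hfS i)
  have hcard3 : ({p 1, p 2, p 3} : Finset V).card = 3 :=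
    Finset.card_eq_three.mpr ⟨_, _, _, hne (by decide), hne (by decide), hne (by decide), rfl⟩
  have hcompl : ({p 1, p 2, p 3} : Finset V)ᶜ.card = Fintype.card V - 3 := by
    rw [Finset.card_compl, hcard3]
  have himage : Finset.univ.image f ⊆ ({p 1, p 2, p 3} : Finset V)ᶜ := by
    intro v hv
    obtain ⟨i, -, rfl⟩ := Finset.mem_image.mp hv
    exact Finset.mem_compl.mpr (hfS i)
  have hcardf : (Finset.univ.image f).card = r := by
    rw [Finset.card_image_of_injective _ hinj, Finset.card_univ, Fintype.card_fin]
  by_contra hr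
  have himage_eq : Finset.univ.image f = ({p 1, p 2, p 3} : Finset V)ᶜ :=
    Finset.eq_of_subset_of_card_le himage (by omega)
  have hsurj : ∀ v, v ∉ ({p 1, p 2, p 3} : Finset V) → ∃ i, f i = v := by
    intro v hv
    have hmem := Finset.mem_compl.mpr hv
    rw [← himage_eq] at hmem
    simpa using hmem
  have honly : ∀ {i v}, v ∈ (T i).verts → v = f i ∨ v = p 1 ∨ v = p 2 ∨ v = p 3 := by
    intro i v hv
    by_cases hvS : v ∈ ({p 1, p 2, p 3} : Finset V)
    · exact Or.inr (by simpa using hvS)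
    · obtain ⟨j, rfl⟩ := hsurj v hvS
      exact Or.inl (congrArg f (huniq (hfT j) hv hvS))
  obtain ⟨i, hi⟩ := hsurj (p 0) (by simp [hp.eq_iff])
  obtain ⟨j, hj⟩ := hsurj (p 4) (by simp [hp.eq_iff])
  have hij : i ≠ j := by
    rintro rfl
    exact hne (a := 0) (b := 4) (by decide) (hi.symm.trans hj)
  have hei : (T i).Adj (p 1) (p 3) := by
    obtain ⟨w, hw⟩ := exists_adj_of_isTree_coe (hS i).2 (h1 i) (h2 i) (hne (by decide))
    have hG := hw.adj_sub
    rcases honly hw.snd_mem with rfl | rfl | rfl | rfl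
    · exact absurd (hi ▸ hG).symm h01
    · exact absurd hG G.irrefl
    · exact absurd hG h12
    · exact hw
  have hej : (T j).Adj (p 1) (p 3) := by
    obtain ⟨w, hw⟩ := exists_adj_of_isTree_coe (hS j).2 (h3 j) (h2 j) (hne (by decide))
    have hG := hw.adj_sub
    rcases honly hw.snd_mem with rfl | rfl | rfl | rfl
    · exact absurd (hj ▸ hG) h34
    · exact hw.symm
    · exact absurd hG.symm h23
    · exact absurd hG G.irrefl
  exact Set.disjoint_left.mp (hd hij).1
    (Subgraph.mem_edgeSet.mpr hei) (Subgraph.mem_edgeSet.mpr hej)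

theorem genConn_three_le_of_component_ge_five (n : ℕ) (M : Set (Sym2 (Fin n)))
    (hM : M ⊆ (⊤ : SimpleGraph (Fin n)).edgeSet)
    (hcomp : ∃ c : (SimpleGraph.fromEdgeSet M).ConnectedComponent, ∃ k, 5 ≤ k ∧
      (CompIsPathOn (SimpleGraph.fromEdgeSet M) c k ∨
        CompIsCycleOn (SimpleGraph.fromEdgeSet M) c k)) :
    genConn ((⊤ : SimpleGraph (Fin n)).deleteEdges M) 3 ≤ n - 4 := by
  obtain ⟨c, k, hk, hc⟩ := hcomp
  obtain ⟨p, hp, hadj⟩ := exists_injective_consecutive hk hc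
  have hnot : ∀ i j : Fin 5, i.val + 1 = j.val →
      ¬ ((⊤ : SimpleGraph (Fin n)).deleteEdges M).Adj (p i) (p j) := by
    intro i j hij h
    exact (deleteEdges_adj.mp h).2 ((fromEdgeSet_adj M).mp (hadj i j hij)).1
  refine csSup_le' ?_
  rintro r ⟨-, hr⟩
  obtain ⟨T, hT⟩ := hr {p 1, p 2, p 3} (Finset.card_eq_three.mpr
    ⟨_, _, _, hp.ne (by decide), hp.ne (by decide), hp.ne (by decide), rfl⟩)
  simpa using card_le_of_isInternallyDisjointSTrees hp (hnot 0 1 rfl) (hnot 1 2 rfl)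
    (hnot 2 3 rfl) (hnot 3 4 rfl) hT
end

section
/- Let G be obtained from the complete graph K_n by deleting an edge set M. If some connected component of the subgraph K_n[M] induced by the edges of M is a cycle on 4 vertices, then κ_3(G) ≤ n − 4. -/
open SimpleGraph

/-- If `s` is closed under adjacency in a preconnected graph and is nonempty, it is everything. -/
theorem SimpleGraph.Preconnected.mem_of_adj_closed {V : Type*} {G : SimpleGraph V}
    (hG : G.Preconnected) {s : Set V} (hs : ∀ u v, G.Adj u v → u ∈ s → v ∈ s)
    {a : V} (ha : a ∈ s) (b : V) : b ∈ s := by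
  obtain ⟨w⟩ := hG a b
  induction w with
  | nil => exact ha
  | cons h _ ih => exact ih (hs _ _ h ha)

/-- A connected subgraph of `G` containing `a` and `b` leaves `{a, b, c, d}` when the pairs
`ab`, `bc`, `cd`, `da` are non-adjacent in `G`. -/
theorem SimpleGraph.Subgraph.exists_mem_verts_notMem_of_four_nonadj {V : Type*}
    {G : SimpleGraph V} {T : G.Subgraph} (hT : T.coe.Preconnected) {a b c d : V}
    (ha : a ∈ T.verts) (hb : b ∈ T.verts) (hba : b ≠ a) (hbc : b ≠ c)
    (hab : ¬ G.Adj a b) (hcb : ¬ G.Adj c b) (hcd : ¬ G.Adj c d) (had : ¬ G.Adj a d) :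
    ∃ v ∈ T.verts, v ≠ a ∧ v ≠ b ∧ v ≠ c ∧ v ≠ d := by
  by_contra! hout
  have hmem := hT.mem_of_adj_closed (s := {v | v.1 = a ∨ v.1 = c}) (a := ⟨a, ha⟩)
    (fun u v huv hu => by
      have hadj : G.Adj u.1 v.1 := T.adj_sub huv
      have hv := hout v.1 v.2
      simp only [Set.mem_ofPred_eq] at hu ⊢
      by_contra! hne
      by_cases hvb : v.1 = b
      · rcases hu with hu | hu <;> rw [hu, hvb] at hadj <;> contradiction
      · have hvd := hv hne.1 hvb hne.2
        rcases hu with hu | hu <;> rw [hu, hvd] at hadj <;> contradiction)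
    (Or.inl rfl) ⟨b, hb⟩
  exact hmem.elim hba hbc

theorem genConn_three_le_of_component_c4 (n : ℕ) (M : Set (Sym2 (Fin n)))
    (hM : M ⊆ (⊤ : SimpleGraph (Fin n)).edgeSet)
    (hcomp : ∃ c : (SimpleGraph.fromEdgeSet M).ConnectedComponent,
      CompIsCycleOn (SimpleGraph.fromEdgeSet M) c 4) :
    genConn ((⊤ : SimpleGraph (Fin n)).deleteEdges M) 3 ≤ n - 4 := by
  obtain ⟨c, ⟨e⟩⟩ := hcomp
  set x : Fin 4 → Fin n := fun i => (e.symm i).1 with hx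
  have hxinj : Function.Injective x := fun i j h => e.symm.injective (Subtype.ext h)
  have hnadj : ∀ i j, (cycleGraph 4).Adj i j →
      ¬ ((⊤ : SimpleGraph (Fin n)).deleteEdges M).Adj (x i) (x j) := by
    intro i j hij hadj
    have h : (SimpleGraph.fromEdgeSet M).Adj (x i) (x j) := e.symm.map_adj_iff.2 hij
    exact (deleteEdges_adj.1 hadj).2 ((fromEdgeSet_adj M).1 h).1
  refine csSup_le' ?_
  rintro r ⟨-, hr⟩
  obtain ⟨T, hT, hdisj⟩ := hr {x 0, x 1, x 2} <| by
    rw [Finset.card_eq_three]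
    exact ⟨_, _, _, hxinj.ne (by decide), hxinj.ne (by decide), hxinj.ne (by decide), rfl⟩
  have hout : ∀ i, ∃ v ∈ (T i).verts, v ≠ x 0 ∧ v ≠ x 1 ∧ v ≠ x 2 ∧ v ≠ x 3 := fun i =>
    Subgraph.exists_mem_verts_notMem_of_four_nonadj (hT i).2.connected.preconnected
      ((hT i).1 (by simp)) ((hT i).1 (by simp)) (hxinj.ne (by decide)) (hxinj.ne (by decide))
      (hnadj _ _ (by decide)) (hnadj _ _ (by decide)) (hnadj _ _ (by decide))
      (hnadj _ _ (by decide))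
  choose f hfT hf0 hf1 hf2 hf3 using hout
  have hfinj : Function.Injective f := by
    intro i j hij
    by_contra hne
    have hmem : f i ∈ (T i).verts ∩ (T j).verts := ⟨hfT i, hij ▸ hfT j⟩
    rw [(hdisj hne).2] at hmem
    simp [hf0, hf1, hf2] at hmem
  have hcard : (Finset.univ.image f).card ≤ ((Finset.univ.image x)ᶜ).card := by
    refine Finset.card_le_card fun v hv => ?_
    obtain ⟨i, -, rfl⟩ := Finset.mem_image.1 hv
    simp only [Finset.mem_compl, Finset.mem_image, Finset.mem_univ, true_and, not_exists]
    intro k hk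
    fin_cases k
    exacts [hf0 i hk.symm, hf1 i hk.symm, hf2 i hk.symm, hf3 i hk.symm]
  simpa [Finset.card_compl, Finset.card_image_of_injective, hfinj, hxinj] using hcard
end

section
/- Let G be obtained from the complete graph K_n by deleting an edge set M. If the subgraph K_n[M] induced by the edges of M has a connected component that is a path on 4 vertices and also has at least one further connected component, then κ_3(G) ≤ n − 4. -/
open SimpleGraph

open Finset in
/-- In a connected subgraph `H` containing `b`, `c`, `x`, where `b`, `c` are non-adjacent and each
vertex of `D` misses at least one of `b`, `c`, `x`, the vertices outside `{b, c, x}` (of weight `1`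
in `D` and `2` elsewhere) and the edges `bx`, `cx` have total weight at least `2`. -/
theorem two_le_weight_of_connected {V : Type*} [DecidableEq V] {G : SimpleGraph V} {b c x : V}
    (hbc : b ≠ c) (hnbc : ¬ G.Adj b c) (D : Finset V)
    (hD : ∀ v ∈ D, ¬ G.Adj b v ∨ ¬ G.Adj c v ∨ ¬ G.Adj x v)
    (H : G.Subgraph) (F : Finset V) (hF : ∀ v, v ∈ F ↔ v ∈ H.verts ∧ v ∉ ({b, c, x} : Finset V))
    (hb : b ∈ H.verts) (hc : c ∈ H.verts) (hx : x ∈ H.verts) (hH : H.coe.Connected)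
    [Decidable (H.Adj b x)] [Decidable (H.Adj c x)] :
    2 ≤ ∑ v ∈ F, (if v ∈ D then 1 else 2) +
      ((if H.Adj b x then 1 else 0) + (if H.Adj c x then 1 else 0)) := by
  have hnt : Nontrivial H.verts := ⟨⟨b, hb⟩, ⟨c, hc⟩, fun h => hbc (congrArg Subtype.val h)⟩
  have nbr : ∀ p ∈ H.verts, ∃ q, H.Adj p q ∧ (q = b ∨ q = c ∨ q = x ∨ q ∈ F) := by
    intro p hp
    obtain ⟨⟨q, hq⟩, hpq⟩ := hH.preconnected.exists_adj_of_nontrivial ⟨p, hp⟩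
    refine ⟨q, hpq, ?_⟩
    have := hF q
    simp only [mem_insert, mem_singleton] at this
    tauto
  have hnbc' : ¬ H.Adj b c := fun h => hnbc h.adj_sub
  have hncb' : ¬ H.Adj c b := fun h => hnbc h.adj_sub.symm
  have hxb : H.Adj x b → H.Adj b x := fun h => h.symm
  have hxc : H.Adj x c → H.Adj c x := fun h => h.symm
  have irr : ∀ p, ¬ H.Adj p p := fun p h => G.loopless.irrefl p h.adj_sub
  obtain ⟨qb, hqb, hqb'⟩ := nbr b hb
  obtain ⟨qc, hqc, hqc'⟩ := nbr c hc
  obtain ⟨qx, hqx, hqx'⟩ := nbr x hx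
  rcases Nat.lt_or_ge 1 F.card with hcard | hcard
  · have : ∑ v ∈ F, 1 ≤ ∑ v ∈ F, (if v ∈ D then 1 else 2) :=
      sum_le_sum fun v _ => by split_ifs <;> omega
    simp only [sum_const, smul_eq_mul, mul_one] at this
    omega
  · have : Nonempty V := ⟨b⟩
    obtain ⟨v, hv⟩ := card_le_one_iff_subset_singleton.1 hcard
    rcases Finset.subset_singleton_iff.1 hv with rfl | rfl
    · have h1 : H.Adj b x := by
        rcases hqb' with rfl | rfl | rfl | h
        exacts [(irr _ hqb).elim, (hnbc' hqb).elim, hqb, by simp at h]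
      have h2 : H.Adj c x := by
        rcases hqc' with rfl | rfl | rfl | h
        exacts [(hncb' hqc).elim, (irr _ hqc).elim, hqc, by simp at h]
      simp [h1, h2]
    · rw [sum_singleton]
      by_cases hvD : v ∈ D
      · have : H.Adj b x ∨ H.Adj c x := by
          simp only [mem_singleton] at hqb' hqc' hqx'
          rcases hD v hvD with h | h | h
          · rcases hqb' with rfl | rfl | rfl | rfl
            exacts [(irr _ hqb).elim, (hnbc' hqb).elim, .inl hqb, (h hqb.adj_sub).elim]
          · rcases hqc' with rfl | rfl | rfl | rfl
            exacts [(hncb' hqc).elim, (irr _ hqc).elim, .inr hqc, (h hqc.adj_sub).elim]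
          · rcases hqx' with rfl | rfl | rfl | rfl
            exacts [.inl (hxb hqx), .inr (hxc hqx), (irr _ hqx).elim, (h hqx.adj_sub).elim]
        rcases this with h | h <;> simp [h, hvD] <;> omega
      · simp [hvD]

/-- Among edge-disjoint subgraphs at most one contains a given edge. -/
theorem sum_ite_adj_le_one {V ι : Type*} [Fintype ι] {G : SimpleGraph V} (T : ι → G.Subgraph)
    (hT : Pairwise fun i j => Disjoint (T i).edgeSet (T j).edgeSet) (p q : V)
    [∀ i, Decidable ((T i).Adj p q)] :
    ∑ i, (if (T i).Adj p q then 1 else 0) ≤ 1 := by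
  rw [Finset.sum_boole, Nat.cast_id, Finset.card_le_one]
  intro i hi j hj
  by_contra hij
  simp only [Finset.mem_filter, Finset.mem_univ, true_and] at hi hj
  exact Set.disjoint_left.1 (hT hij) (Subgraph.mem_edgeSet.2 hi) (Subgraph.mem_edgeSet.2 hj)

open Finset in
/-- If `b`, `c` are non-adjacent and `D` is a set of three further vertices, each missing at least
one of `b`, `c`, `x`, then there are at most `|V| - 4` internally disjoint `{b, c, x}`-trees. -/
theorem IsInternallyDisjointSTrees.add_four_le_card {V : Type*} [Fintype V] [DecidableEq V]
    {G : SimpleGraph V} {b c x : V} (hbc : b ≠ c) (hbx : b ≠ x) (hcx : c ≠ x)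
    (hnbc : ¬ G.Adj b c) {D : Finset V} (hDcard : D.card = 3) (hDdisj : Disjoint D {b, c, x})
    (hD : ∀ v ∈ D, ¬ G.Adj b v ∨ ¬ G.Adj c v ∨ ¬ G.Adj x v) {r : ℕ} {T : Fin r → G.Subgraph}
    (hT : IsInternallyDisjointSTrees G (↑({b, c, x} : Finset V)) T) :
    r + 4 ≤ Fintype.card V := by
  classical
  obtain ⟨htree, hdisj⟩ := hT
  have hS : ({b, c, x} : Finset V).card = 3 := card_eq_three.2 ⟨b, c, x, hbc, hbx, hcx, rfl⟩
  let F : Fin r → Finset V := fun i =>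
    univ.filter fun v => v ∈ (T i).verts ∧ v ∉ ({b, c, x} : Finset V)
  let w : V → ℕ := fun v => if v ∈ D then 1 else 2
  have htree_weight : ∀ i, 2 ≤ ∑ v ∈ F i, w v +
      ((if (T i).Adj b x then 1 else 0) + (if (T i).Adj c x then 1 else 0)) := fun i =>
    two_le_weight_of_connected hbc hnbc D hD (T i) (F i) (by simp [F])
      ((htree i).1 (by simp)) ((htree i).1 (by simp)) ((htree i).1 (by simp))
      (htree i).2.1
  have hsum := sum_le_sum fun i (_ : i ∈ (univ : Finset (Fin r))) => htree_weight i
  rw [sum_add_distrib, sum_add_distrib, sum_const, card_univ, Fintype.card_fin, smul_eq_mul] at hsum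
  have hedges : Pairwise fun i j => Disjoint (T i).edgeSet (T j).edgeSet :=
    fun i j hij => (hdisj hij).1
  have hb := sum_ite_adj_le_one T hedges b x
  have hc := sum_ite_adj_le_one T hedges c x
  have hFdisj : Set.PairwiseDisjoint (↑(univ : Finset (Fin r))) F := by
    intro i _ j _ hij
    refine Finset.disjoint_left.2 fun v hi hj => ?_
    simp only [F, mem_filter, mem_univ, true_and] at hi hj
    have hv : v ∈ (T i).verts ∩ (T j).verts := ⟨hi.1, hj.1⟩
    rw [(hdisj hij).2] at hv
    exact hi.2 (mem_coe.1 hv)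
  have hout : ∑ i, ∑ v ∈ F i, w v ≤ ∑ v ∈ ({b, c, x} : Finset V)ᶜ, w v := by
    rw [← sum_biUnion hFdisj]
    refine sum_le_sum_of_subset fun v hv => ?_
    obtain ⟨i, -, hi⟩ := mem_biUnion.1 hv
    exact mem_compl.2 (mem_filter.1 hi).2.2
  have htotal : ∑ v ∈ ({b, c, x} : Finset V)ᶜ, w v + D.card =
      2 * (({b, c, x} : Finset V)ᶜ).card := by
    have hsub : D ⊆ ({b, c, x} : Finset V)ᶜ := fun v hv =>
      mem_compl.2 (Finset.disjoint_left.1 hDdisj hv)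
    have hDsum : D.card = ∑ v ∈ ({b, c, x} : Finset V)ᶜ, if v ∈ D then 1 else 0 := by
      rw [sum_boole, Nat.cast_id, filter_mem_eq_inter, inter_eq_right.2 hsub]
    rw [hDsum, ← sum_add_distrib, mul_comm, ← smul_eq_mul, ← sum_const]
    refine sum_congr rfl fun v _ => ?_
    by_cases h : v ∈ D <;> simp [w, h]
  rw [hDcard, card_compl, hS] at htotal
  have hle : D.card + ({b, c, x} : Finset V).card ≤ Fintype.card V := by
    rw [← card_union_of_disjoint hDdisj]
    exact card_le_univ _
  omega

theorem genConn_three_le_of_component_p4_and_other (n : ℕ) (M : Set (Sym2 (Fin n)))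
    (hM : M ⊆ (⊤ : SimpleGraph (Fin n)).edgeSet)
    (hcomp : ∃ c : (SimpleGraph.fromEdgeSet M).ConnectedComponent,
      CompIsPathOn (SimpleGraph.fromEdgeSet M) c 4 ∧
      ∃ e ∈ M, ∃ v : Fin n, v ∈ e ∧ v ∉ c.supp) :
    genConn ((⊤ : SimpleGraph (Fin n)).deleteEdges M) 3 ≤ n - 4 := by
  obtain ⟨K, ⟨φ⟩, e, he, x, hxe, hx⟩ := hcomp
  obtain ⟨y, rfl⟩ := Sym2.mem_iff_exists.1 hxe
  have hxy : (fromEdgeSet M).Adj x y := (fromEdgeSet_adj M).2 ⟨he, hM he⟩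
  have hy : y ∉ K.supp := fun h => hx (K.mem_supp_of_adj_mem_supp h hxy.symm)
  let f : Fin 4 → Fin n := fun i => (φ.symm i).1
  have hfinj : Function.Injective f := Subtype.val_injective.comp φ.symm.injective
  have hfK : ∀ i, f i ∈ K.supp := fun i => (φ.symm i).2
  have hfadj : ∀ i j, (pathGraph 4).Adj i j → (fromEdgeSet M).Adj (f i) (f j) :=
    fun i j h => φ.symm.map_adj_iff.2 h
  have hfx : ∀ i, f i ≠ x := fun i h => hx (h ▸ hfK i)
  have hfy : ∀ i, f i ≠ y := fun i h => hy (h ▸ hfK i)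
  have hne : ∀ i j, i ≠ j → f i ≠ f j := fun i j h => hfinj.ne h
  have hnadj : ∀ p q, (fromEdgeSet M).Adj p q →
      ¬ ((⊤ : SimpleGraph (Fin n)).deleteEdges M).Adj p q :=
    fun p q h h' => (deleteEdges_adj.1 h').2 ((fromEdgeSet_adj M).1 h).1
  have h10 := hnadj _ _ (hfadj 1 0 (by simp [pathGraph_adj]))
  have h12 := hnadj _ _ (hfadj 1 2 (by simp [pathGraph_adj]))
  have h23 := hnadj _ _ (hfadj 2 3 (by simp [pathGraph_adj]))
  have n01 := hne 0 1 (by decide)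
  have n02 := hne 0 2 (by decide)
  have n03 := hne 0 3 (by decide)
  have n12 := hne 1 2 (by decide)
  have n13 := hne 1 3 (by decide)
  have n23 := hne 2 3 (by decide)
  refine csSup_le' ?_
  rintro r ⟨-, hr⟩
  obtain ⟨T, hT⟩ := hr {f 1, f 2, x} (Finset.card_eq_three.2 ⟨_, _, _, n12, hfx 1, hfx 2, rfl⟩)
  have := hT.add_four_le_card n12 (hfx 1) (hfx 2) h12 (D := {f 0, f 3, y})
    (Finset.card_eq_three.2 ⟨_, _, _, n03, hfy 0, hfy 3, rfl⟩)
    (by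
      simp only [Finset.disjoint_left, Finset.mem_insert, Finset.mem_singleton]
      rintro v (rfl | rfl | rfl)
      · simp [n01, n02, hfx]
      · simp [n13.symm, n23.symm, hfx]
      · simp [(hfy _).symm, hxy.ne'])
    (by
      simp only [Finset.mem_insert, Finset.mem_singleton]
      rintro v (rfl | rfl | rfl)
      exacts [.inl h10, .inr (.inl h23), .inr (.inr (hnadj _ _ hxy))])
  rw [Fintype.card_fin] at this
  omega
end
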